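/- arXiv:1401.0189 — 4 statements merged into one kernel-verified Lean document; each statement's English description precedes it below -/
import Mathlib

section
/- For every prime power q ≥ 3 there exist constants δ, ε ∈ (0,1) depending only on q (one may take δ = 1/(20 q ln q) and any ε with 1/10 + 1/(20 q ln q) < ε < 1/2) such that for all sufficiently large prime powers n the following holds: whenever NW_{n,ε}, regarded as a polynomial with coefficients in F_q, is written as NW_{n,ε} = Σ_{i=1}^{s} Π_{j=1}^{d_i} L_{i,j} where each L_{i,j} is a polynomial of total degree at most 1 in the variables x_{ij}, (i,j) ∈ F_n × F_n, over F_q, then s ≥ n^{δ n}. In particular, every depth-three ΣΠΣ circuit over F_q computing NW_{n,ε} has size at least 2^{δ n log₂ n}. -/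
open MvPolynomial

noncomputable section

/-- Evaluation at `i` of the univariate polynomial with coefficient vector `a`
(coefficient vectors of length `d` correspond bijectively to univariate polynomials
of degree `< d`). -/
def polyEval {Fn : Type*} [CommRing Fn] {d : ℕ} (a : Fin d → Fn) (i : Fn) : Fn :=
  ∑ k : Fin d, a k * i ^ (k : ℕ)

/-- The Nisan–Wigderson polynomial over the coefficient field `K`, with variables indexed
by `Fn × Fn`, summing over all univariate polynomials over `Fn` of degree `< d`
(encoded by their coefficient vectors `a : Fin d → Fn`). For `d = ⌈ε·n⌉` this is
`NW_{n,ε}`. -/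
def NW (Fn : Type*) [CommRing Fn] [Fintype Fn] (K : Type*) [CommSemiring K] (d : ℕ) :
    MvPolynomial (Fn × Fn) K :=
  ∑ a : Fin d → Fn, ∏ i : Fn, X (i, polyEval a i)

theorem affine_eq {σ K : Type} [Fintype σ] [DecidableEq σ] [Field K] (L : MvPolynomial σ K)
    (h : L.totalDegree ≤ 1) :
    L = C (coeff 0 L) + ∑ p, C (coeff (Finsupp.single p 1) L) * X p := by
  classical
  ext m
  simp only [coeff_add, coeff_sum, coeff_C, coeff_C_mul, coeff_X]
  by_cases hm : m ∈ L.support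
  · have h1 := (le_totalDegree hm).trans h
    have h2 : m.degree ≤ 1 := h1
    rcases Nat.le_one_iff_eq_zero_or_eq_one.1 h2 with h3 | h3
    · rw [Finsupp.degree_eq_zero_iff] at h3
      subst h3
      simp
    · obtain ⟨p, rfl⟩ : ∃ p, m = Finsupp.single p 1 := by
        exact (Finsupp.sum_eq_one_iff m).1 h3
      have hne : ¬ ((0 : σ →₀ ℕ) = Finsupp.single p 1) := by
        intro h; rw [← h] at h3; simp at h3
      rw [Finset.sum_eq_single p]
      · simp [hne]
      · intro b _ hb
        simp [Finsupp.single_left_inj, hb]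
      · simp
  · have h0 : coeff m L = 0 := by simpa using hm
    rw [h0]
    symm
    have : ∀ p, (coeff (Finsupp.single p 1) L * if Finsupp.single p 1 = m then (1:K) else 0) = 0 := by
      intro p
      split_ifs with hp
      · rw [hp, h0]; simp
      · simp
    simp only [this]
    split_ifs with hz
    · rw [hz, h0]; simp
    · simp

/-- Products of many polynomials with zero constant term have no low-degree coefficients. -/
theorem coeff_prod_eq_zero {σ K ι : Type} [Field K] [DecidableEq K] (J : Finset ι) (f : ι → MvPolynomial σ K)
    (m : σ →₀ ℕ) (hm : m.degree < (J.filter (fun j => coeff 0 (f j) = 0)).card) :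
    coeff m (∏ j ∈ J, f j) = 0 := by
  classical
  induction J using Finset.induction_on generalizing m with
  | empty => simp at hm
  | insert a J ha ih =>
    rw [Finset.prod_insert ha, coeff_mul]
    apply Finset.sum_eq_zero
    rintro ⟨x, y⟩ hxy
    rw [Finset.HasAntidiagonal.mem_antidiagonal] at hxy
    simp only at hxy ⊢
    have hd : m.degree = x.degree + y.degree := by rw [← hxy, map_add]
    rw [Finset.filter_insert] at hm
    split_ifs at hm with h0
    · rw [Finset.card_insert_of_notMem (by simp [ha])] at hm
      by_cases hx : x = 0
      · subst hx; rw [h0]; simp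
      · have : x.degree ≠ 0 := fun h => hx ((Finsupp.degree_eq_zero_iff x).1 h)
        rw [ih y (by omega)]; simp
    · rw [ih y (by omega)]; simp

theorem polyEval_inj {F : Type} [Field F] {d : ℕ} (a b : Fin d → F) (S : Finset F) (hS : d ≤ S.card)
    (h : ∀ i ∈ S, polyEval a i = polyEval b i) : a = b := by
  obtain ⟨T, hT, hTc⟩ := Finset.exists_subset_card_eq hS
  let e := (T.equivFinOfCardEq hTc).symm
  have : a - b = 0 := by
    apply Matrix.eq_zero_of_forall_index_sum_pow_mul_eq_zero (f := fun j => ((e j : T) : F))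
    · intro x y hxy
      exact e.injective (Subtype.ext hxy)
    · intro j
      have := h (e j) (hT (e j).2)
      simp only [polyEval] at this
      rw [← sub_eq_zero, ← Finset.sum_sub_distrib] at this
      rw [← this]
      apply Finset.sum_congr rfl
      intros; simp; ring
  exact sub_eq_zero.1 this

/-- Rank dichotomy. -/
theorem dichotomy {K V ι : Type} [Field K] [AddCommGroup V] [Module K V] (l : ι → V →ₗ[K] K) (t : ℕ) :
    (∃ e : Fin t → ι, ∀ w : Fin t → K, ∃ v, ∀ j, l (e j) v = w j) ∨
    (∃ rep : (Fin t → K) → V, ∀ v, ∃ w, ∀ i, l i (rep w) = l i v) := by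
  classical
  have key : (∃ e : Fin t → ι, ∀ w : Fin t → K, ∃ v, ∀ j, l (e j) v = w j) ∨
    (∃ r, r ≤ t ∧ ∃ e : Fin r → ι, ∀ v, (∀ j, l (e j) v = 0) → ∀ i, l i v = 0) := by
    induction t with
    | zero => left; exact ⟨Fin.elim0, fun w => ⟨0, fun j => j.elim0⟩⟩
    | succ t ih =>
      rcases ih with ⟨e, he⟩ | ⟨r, hr, e, he⟩
      · by_cases h : ∀ v, (∀ j, l (e j) v = 0) → ∀ i, l i v = 0
        · right; exact ⟨t, by omega, e, h⟩
        · left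
          push Not at h
          obtain ⟨v0, hv0, i0, hi0⟩ := h
          refine ⟨Fin.snoc e i0, fun w => ?_⟩
          obtain ⟨v1, hv1⟩ := he (fun j => w j.castSucc)
          refine ⟨v1 + ((w (Fin.last t) - l i0 v1) / l i0 v0) • v0, fun j => ?_⟩
          refine Fin.lastCases ?_ (fun j => ?_) j
          · simp [hi0]
          · simp [hv1, hv0]
      · right; exact ⟨r, by omega, e, he⟩
  rcases key with h | ⟨r, hr, e, he⟩
  · left; exact h
  · right
    refine ⟨fun w => if h : ∃ v, ∀ j : Fin r, l (e j) v = w (Fin.castLE hr j) then h.choose else 0, fun v => ?_⟩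
    refine ⟨fun x => if hx : x.1 < r then l (e ⟨x.1, hx⟩) v else 0, fun i => ?_⟩
    have hex : ∃ v', ∀ j : Fin r, l (e j) v' = (fun x : Fin t => if hx : x.1 < r then l (e ⟨x.1, hx⟩) v else 0) (Fin.castLE hr j) :=
      ⟨v, fun j => by simp⟩
    beta_reduce
    rw [dif_pos hex]
    have := hex.choose_spec
    rw [← sub_eq_zero, ← map_sub]
    apply he
    intro j
    rw [map_sub, this j]; simp

theorem bad_count {K V : Type} [Field K] [Fintype K] [DecidableEq K] [AddCommGroup V] [Module K V] [Fintype V]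
    {t : ℕ} (l : Fin t → V →ₗ[K] K) (hl : ∀ w : Fin t → K, ∃ v, ∀ j, l j v = w j) (c : Fin t → K) (k : ℕ) :
    (((Finset.univ.filter fun v : V => (Finset.univ.filter fun j => c j + l j v = 0).card ≤ k).card : ℕ) : ℝ)
      ≤ 2 ^ k * (1 - 1 / (2 * (Fintype.card K : ℝ))) ^ t * Fintype.card V := by
  classical
  set q := Fintype.card K
  have hq : 0 < (q : ℝ) := by exact_mod_cast Fintype.card_pos
  let φ : Fin t → K → ℝ := fun j x => if c j + x = 0 then 1/2 else 1
  let Λ : V →+ (Fin t → K) := (LinearMap.pi l).toAddMonoidHom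
  have hΛ : Function.Surjective Λ := fun w => by
    obtain ⟨v, hv⟩ := hl w
    exact ⟨v, funext hv⟩
  -- fibers
  let m := (Finset.univ.filter fun v => Λ v = 0).card
  have hm : ∀ w, (Finset.univ.filter fun v => Λ v = w).card = m := fun w =>
    AddMonoidHom.card_fiber_eq_of_mem_range Λ (hΛ w) (hΛ 0)
  have hVm : (Fintype.card V : ℝ) = q ^ t * m := by
    have := Finset.card_eq_sum_card_fiberwise (f := Λ) (s := (Finset.univ : Finset V)) (t := Finset.univ) (by simp)
    simp only [hm] at this
    rw [Finset.card_univ] at this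
    rw [this]; simp [q]
  have hsum : ∑ v : V, ∏ j, φ j (Λ v j) = m * (q - 1/2) ^ t := by
    rw [← Finset.sum_fiberwise (s := Finset.univ) (g := Λ)]
    have : ∀ w, ∑ v with Λ v = w, ∏ j, φ j (Λ v j) = m * ∏ j, φ j (w j) := by
      intro w
      rw [Finset.sum_congr rfl (g := fun _ => ∏ j, φ j (w j))]
      · rw [Finset.sum_const, hm]; simp
      · intro v hv; simp at hv; rw [hv]
    simp only [this, ← Finset.mul_sum]
    congr 1
    have h2 := Finset.prod_univ_sum (fun _ : Fin t => (Finset.univ : Finset K)) φ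
    rw [Fintype.piFinset_univ] at h2
    rw [← h2]
    have : ∀ j, ∑ x, φ j x = (q : ℝ) - 1/2 := by
      intro j
      have : ∀ x, φ j x = 1 - if x = - c j then 1/2 else 0 := by
        intro x
        have : c j + x = 0 ↔ x = - c j := by rw [add_comm, eq_neg_iff_add_eq_zero]
        simp only [φ, this]
        split_ifs <;> norm_num
      simp only [this, Finset.sum_sub_distrib]
      simp [q]
    simp [this]
  have hlow : (((Finset.univ.filter fun v : V => (Finset.univ.filter fun j => c j + l j v = 0).card ≤ k).card : ℕ) : ℝ) * (1/2)^k
      ≤ ∑ v : V, ∏ j, φ j (Λ v j) := by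
    rw [← nsmul_eq_mul, ← Finset.sum_const]
    apply (Finset.sum_le_sum _).trans (Finset.sum_le_sum_of_subset_of_nonneg (Finset.subset_univ _) _)
    · intro v hv
      simp only [Finset.mem_filter, Finset.mem_univ, true_and] at hv
      have : ∏ j, φ j (Λ v j) = (1/2) ^ (Finset.univ.filter fun j => c j + l j v = 0).card := by
        simp only [φ]
        rw [Finset.prod_ite]
        simp [Λ]
        congr!
      rw [this]
      exact pow_le_pow_of_le_one (by norm_num) (by norm_num) hv
    · intro v _ _
      apply Finset.prod_nonneg
      intro j _
      simp only [φ]; split_ifs <;> norm_num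
  rw [hsum] at hlow
  have e1 : 2 ^ k * (1 - 1 / (2 * (q : ℝ))) ^ t * (Fintype.card V : ℝ) = 2 ^ k * (m * (q - 1/2) ^ t) := by
    rw [hVm]
    have : (q : ℝ) - 1/2 = (1 - 1 / (2 * (q : ℝ))) * q := by field_simp
    rw [this, mul_pow]; ring
  rw [e1]
  have h2 : (2:ℝ)^k * (1/2)^k = 1 := by rw [← mul_pow]; norm_num
  calc _ = (2:ℝ)^k * ((((Finset.univ.filter fun v : V => (Finset.univ.filter fun j => c j + l j v = 0).card ≤ k).card : ℕ) : ℝ) * (1/2)^k) := by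
        rw [mul_comm _ ((1/2:ℝ)^k), ← mul_assoc, h2, one_mul]
    _ ≤ _ := by gcongr

def theta {F K : Type} [DecidableEq F] [Field K] (S : Finset F) (v : F × F → K) :
    MvPolynomial (F × F) K →ₐ[K] MvPolynomial (F × F) K :=
  aeval (fun p => if p.1 ∈ S then X p else C (v p))

def ell {F K : Type} [DecidableEq F] [Fintype F] [Field K] (S : Finset F) (L : MvPolynomial (F × F) K) :
    (F × F → K) →ₗ[K] K :=
  ∑ p : F × F, (if p.1 ∈ S then 0 else coeff (Finsupp.single p 1) L) • LinearMap.proj p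

theorem theta_affine {F K : Type} [DecidableEq F] [Fintype F] [Field K] (S : Finset F) (v : F × F → K)
    (L : MvPolynomial (F × F) K) (h : L.totalDegree ≤ 1) :
    theta S v L = C (coeff 0 L + ell S L v) +
      ∑ p : F × F, if p.1 ∈ S then C (coeff (Finsupp.single p 1) L) * X p else 0 := by
  conv_lhs => rw [affine_eq L h]
  simp only [map_add, map_sum, map_mul, theta, aeval_X, ell, LinearMap.sum_apply, LinearMap.smul_apply,
    LinearMap.proj_apply, algHom_C, algebraMap_eq, add_assoc, smul_eq_mul]
  congr 1
  rw [← Finset.sum_add_distrib]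
  apply Finset.sum_congr rfl
  intro p _
  split_ifs <;> simp

theorem coeff_zero_theta {F K : Type} [DecidableEq F] [Fintype F] [Field K] (S : Finset F) (v : F × F → K)
    (L : MvPolynomial (F × F) K) (h : L.totalDegree ≤ 1) :
    coeff 0 (theta S v L) = coeff 0 L + ell S L v := by
  rw [theta_affine S v L h, coeff_add, coeff_C, if_pos rfl, coeff_sum]
  rw [Finset.sum_eq_zero, add_zero]
  intro p _
  split_ifs
  · rw [coeff_C_mul, coeff_X]
    have hne : ¬ (Finsupp.single p 1 = (0 : F × F →₀ ℕ)) := by simp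
    simp
  · simp

def mon {F : Type} [Field F] {d : ℕ} (S : Finset F) (a : Fin d → F) : F × F →₀ ℕ :=
  ∑ i ∈ S, Finsupp.single (i, polyEval a i) 1

theorem mon_degree {F : Type} [Field F] {d : ℕ} (S : Finset F) (a : Fin d → F) :
    (mon S a).degree = S.card := by
  simp [mon]

theorem mon_inj {F : Type} [Field F] {d : ℕ} (S : Finset F) (hS : d ≤ S.card) (a b : Fin d → F)
    (h : mon S a = mon S b) : a = b := by
  classical
  apply polyEval_inj a b S hS
  intro i hi
  by_contra hne
  have h1 : mon S a (i, polyEval a i) = mon S b (i, polyEval a i) := by rw [h]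
  simp only [mon, Finsupp.finsetSum_apply, Finsupp.single_apply, Prod.mk.injEq] at h1
  rw [Finset.sum_eq_zero (s := S) (f := fun x => if x = i ∧ polyEval b x = polyEval a i then 1 else 0)] at h1
  · rw [Finset.sum_eq_zero_iff] at h1
    have := h1 i hi
    simp at this
  · intro x _
    rw [if_neg]
    rintro ⟨rfl, h2⟩
    exact hne h2.symm

theorem coeff_theta_NW {F K : Type} [DecidableEq F] [Field F] [Fintype F] [Field K] {d : ℕ}
    (S : Finset F) (hS : d ≤ S.card) (v : F × F → K) (a : Fin d → F) :
    coeff (mon S a) (theta S v (NW F K d)) = ∏ i ∈ Sᶜ, v (i, polyEval a i) := by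
  classical
  have h : ∀ b : Fin d → F, theta S v (∏ i : F, X (i, polyEval b i)) =
      monomial (mon S b) (∏ i ∈ Sᶜ, v (i, polyEval b i)) := by
    intro b
    rw [map_prod, ← Finset.prod_mul_prod_compl S, mon, monomial_sum_index, mul_comm, map_prod]
    congr 1
    · apply Finset.prod_congr rfl
      intro i hi
      have : i ∉ S := by simpa using hi
      simp [theta, this]
    · apply Finset.prod_congr rfl
      intro i hi
      rw [show (monomial (Finsupp.single (i, polyEval b i) 1) (1 : K)) = X (i, polyEval b i) from rfl]
      rw [theta, aeval_X, if_pos hi]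
  rw [NW, map_sum, coeff_sum]
  simp only [h, coeff_monomial]
  rw [Finset.sum_eq_single a]
  · simp
  · intro b _ hb
    rw [if_neg]
    intro h2
    exact hb (mon_inj S hS b a h2)
  · simp

/-- Shift along the diagonal of `a`. -/
def shiftVec {F K : Type} [DecidableEq F] [Field F] [Field K] {d : ℕ} (a : Fin d → F) (A : Finset F) : F × F → K :=
  fun p => if p.1 ∈ A ∧ polyEval a p.1 = p.2 then 1 else 0

theorem alt_sum {F K : Type} [DecidableEq F] [Field F] [Fintype F] [Field K] {d : ℕ}
    (T : Finset F) (hT : d ≤ T.card) (v : F × F → K) (a b : Fin d → F) :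
    ∑ A ∈ T.powerset, (-1 : K) ^ (T \ A).card * ∏ i ∈ T, (v + shiftVec (K := K) a A) (i, polyEval b i)
      = if b = a then 1 else 0 := by
  have h1 : ∏ i ∈ T, ((v (i, polyEval b i) + if polyEval a i = polyEval b i then (1 : K) else 0) +
      (- v (i, polyEval b i))) = if b = a then 1 else 0 := by
    split_ifs with hab
    · subst hab; simp
    · have : ∃ i ∈ T, polyEval a i ≠ polyEval b i := by
        by_contra hcon
        push Not at hcon
        exact hab (polyEval_inj a b T hT hcon).symm
      obtain ⟨i, hi, hne⟩ := this
      apply Finset.prod_eq_zero hi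
      simp [hne]
  rw [← h1, Finset.prod_add]
  apply Finset.sum_congr rfl
  intro A hA
  rw [Finset.mem_powerset] at hA
  rw [Finset.prod_neg, ← Finset.prod_sdiff hA]
  have e1 : ∏ i ∈ T \ A, (v + shiftVec (K := K) a A) (i, polyEval b i) = ∏ i ∈ T \ A, v (i, polyEval b i) := by
    apply Finset.prod_congr rfl
    intro i hi
    have : i ∉ A := (Finset.mem_sdiff.1 hi).2
    simp [shiftVec, this]
  have e2 : ∏ i ∈ A, (v + shiftVec (K := K) a A) (i, polyEval b i) =
      ∏ i ∈ A, (v (i, polyEval b i) + if polyEval a i = polyEval b i then (1 : K) else 0) := by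
    apply Finset.prod_congr rfl
    intro i hi
    simp [shiftVec, hi]
  rw [e1, e2]; ring

theorem core {K F : Type} [Field K] [Fintype K] [Field F] [Fintype F] (k t s : ℕ)
    (hk : 2 * k ≤ Fintype.card F) (d : ℕ → ℕ) (L : ℕ → ℕ → MvPolynomial (F × F) K)
    (hL : ∀ i < s, ∀ j < d i, (L i j).totalDegree ≤ 1)
    (hNW : NW F K k = ∑ i ∈ Finset.range s, ∏ j ∈ Finset.range (d i), L i j)
    (hsmall : (s : ℝ) * 4 ^ (Fintype.card F) * (1 - 1 / (2 * (Fintype.card K : ℝ))) ^ t < 1) :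
    Fintype.card F ^ k ≤ s * Fintype.card K ^ t := by
  classical
  by_contra hcon
  push Not at hcon
  obtain ⟨S, -, hS⟩ := Finset.exists_subset_card_eq (s := (Finset.univ : Finset F)) (n := k) (by
    rw [Finset.card_univ]; omega)
  have hSc : k ≤ Sᶜ.card := by rw [Finset.card_compl, hS]; omega
  set V := F × F → K
  -- linear forms
  let l : (i : Fin s) → Fin (d i) → V →ₗ[K] K := fun i j => ell S (L i j)
  let high : Fin s → Prop := fun i => ∃ e : Fin t → Fin (d i), ∀ w : Fin t → K, ∃ v, ∀ j, l i (e j) v = w j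
  have hrep : ∀ i : Fin s, ∃ rep : (Fin t → K) → V, ¬ high i → ∀ v, ∃ w, ∀ j, l i j (rep w) = l i j v := by
    intro i
    rcases dichotomy (l i) t with h | ⟨rep, h⟩
    · exact ⟨fun _ => 0, fun h' => absurd h h'⟩
    · exact ⟨rep, fun _ => h⟩
  choose rep hrep using hrep
  let T : Fin s → V → (Fin k → F) → K := fun i v a =>
    coeff (mon S a) (theta S v (∏ j ∈ Finset.range (d i), L i j))
  have hTsum : ∀ v a, ∑ i, T i v a = ∏ x ∈ Sᶜ, v (x, polyEval a x) := by
    intro v a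
    rw [← coeff_theta_NW S hS.ge v a, hNW, Finset.sum_range, map_sum, coeff_sum]
  have hTprod : ∀ (i : Fin s) v, theta S v (∏ j ∈ Finset.range (d i), L i j) =
      ∏ j : Fin (d i), theta S v (L i j) := by
    intro i v
    rw [map_prod, Finset.prod_range]
  -- low rank
  have hlow : ∀ (i : Fin s) v v' a, (∀ j, l i j v = l i j v') → T i v a = T i v' a := by
    intro i v v' a h
    simp only [T, hTprod]
    congr 1
    apply Finset.prod_congr rfl
    intro j _
    rw [theta_affine S v _ (hL i i.2 j j.2), theta_affine S v' _ (hL i i.2 j j.2)]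
    have := h j
    simp only [l] at this
    rw [this]
  -- high rank
  have hbad : ∀ i : Fin s, ∃ B : Finset V, (B.card : ℝ) ≤
      2 ^ k * (1 - 1 / (2 * (Fintype.card K : ℝ))) ^ t * Fintype.card V ∧
      (high i → ∀ v ∉ B, ∀ a, T i v a = 0) := by
    intro i
    by_cases hi : high i
    · obtain ⟨e, he⟩ := hi
      refine ⟨_, bad_count (fun j => l i (e j)) he (fun j => coeff 0 (L i (e j))) k, fun _ v hv a => ?_⟩
      simp only [Finset.mem_filter, Finset.mem_univ, true_and, not_le] at hv
      simp only [T, hTprod]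
      apply coeff_prod_eq_zero
      rw [mon_degree, hS]
      apply hv.trans_le
      apply Finset.card_le_card_of_injOn e
      · intro j hj
        simp only [Finset.coe_filter, Finset.mem_univ, true_and, Set.mem_ofPred_eq] at hj ⊢
        rw [coeff_zero_theta S v _ (hL i i.2 _ (e j).2)]
        exact hj
      · intro x _ y _ hxy
        by_contra hne
        obtain ⟨v, hv⟩ := he (Pi.single x 1)
        have h1 := hv x
        have h2 := hv y
        rw [hxy, h2] at h1
        simp [Pi.single_apply, Ne.symm hne] at h1
    · refine ⟨∅, ?_, fun h => absurd h hi⟩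
      have hq : (1:ℝ) ≤ Fintype.card K := by exact_mod_cast Fintype.card_pos
      have : 0 ≤ 1 - 1 / (2 * (Fintype.card K : ℝ)) := by
        rw [sub_nonneg, div_le_one (by linarith)]; linarith
      simp only [Finset.card_empty, Nat.cast_zero]
      positivity
  choose B hB1 hB2 using hbad
  let E : Finset V := Finset.univ.biUnion B
  have hE : (E.card : ℝ) * 2 ^ Fintype.card F < Fintype.card V := by
    have h1 : (E.card : ℝ) ≤ s * (2 ^ k * (1 - 1 / (2 * (Fintype.card K : ℝ))) ^ t * Fintype.card V) := by
      calc (E.card : ℝ) ≤ ((∑ i, (B i).card : ℕ) : ℝ) := by exact_mod_cast Finset.card_biUnion_le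
        _ = ∑ i, ((B i).card : ℝ) := by push_cast; rfl
        _ ≤ ∑ i : Fin s, _ := Finset.sum_le_sum fun i _ => hB1 i
        _ = _ := by simp
    have hq : (1:ℝ) ≤ Fintype.card K := by exact_mod_cast Fintype.card_pos
    have hr : 0 ≤ 1 - 1 / (2 * (Fintype.card K : ℝ)) := by
      rw [sub_nonneg, div_le_one (by linarith)]; linarith
    have hV : (0:ℝ) < Fintype.card V := by exact_mod_cast Fintype.card_pos
    have h2 : (2:ℝ) ^ k ≤ 2 ^ Fintype.card F := pow_le_pow_right₀ (by norm_num) (by omega)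
    have h4 : (4:ℝ) ^ Fintype.card F = 2 ^ Fintype.card F * 2 ^ Fintype.card F := by
      rw [← mul_pow]; norm_num
    rw [h4] at hsmall
    calc _ ≤ (s * (2 ^ k * (1 - 1 / (2 * (Fintype.card K : ℝ))) ^ t * Fintype.card V)) * (2:ℝ) ^ Fintype.card F := by
          gcongr
      _ ≤ (s * (2 ^ Fintype.card F * (1 - 1 / (2 * (Fintype.card K : ℝ))) ^ t * Fintype.card V)) * (2:ℝ) ^ Fintype.card F := by
          gcongr
      _ = (s * (2 ^ Fintype.card F * 2 ^ Fintype.card F) * (1 - 1 / (2 * (Fintype.card K : ℝ))) ^ t) * Fintype.card V := by ring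
      _ < 1 * Fintype.card V := by gcongr
      _ = _ := one_mul _
  -- kernel vector
  let Ψ : ((Fin k → F) → K) →ₗ[K] (Fin s × (Fin t → K) → K) :=
    LinearMap.pi fun x => ∑ a, T x.1 (rep x.1 x.2) a • LinearMap.proj a
  have hker : LinearMap.ker Ψ ≠ ⊥ := by
    apply LinearMap.ker_ne_bot_of_finrank_lt
    simpa using hcon
  obtain ⟨c, hc, hc0⟩ := (Submodule.ne_bot_iff _).1 hker
  have hc1 : ∀ i w, ∑ a, T i (rep i w) a * c a = 0 := by
    intro i w
    have := congrFun (LinearMap.mem_ker.1 hc) (i, w)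
    simpa [Ψ] using this
  obtain ⟨a0, ha0⟩ : ∃ a, c a ≠ 0 := Function.ne_iff.1 hc0
  have hzero : ∀ v ∉ E, ∑ a, (∏ x ∈ Sᶜ, v (x, polyEval a x)) * c a = 0 := by
    intro v hv
    simp only [← hTsum, Finset.sum_mul]
    rw [Finset.sum_comm]
    apply Finset.sum_eq_zero
    intro i _
    by_cases hi : high i
    · apply Finset.sum_eq_zero
      intro a _
      rw [hB2 i hi v (fun h => hv (Finset.mem_biUnion.2 ⟨i, Finset.mem_univ _, h⟩)) a, zero_mul]
    · obtain ⟨w, hw⟩ := hrep i hi v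
      rw [← hc1 i w]
      apply Finset.sum_congr rfl
      intro a _
      rw [hlow i _ _ a hw]
  -- good base point
  obtain ⟨v, hv⟩ : ∃ v : V, ∀ A ∈ Sᶜ.powerset, v + shiftVec a0 A ∉ E := by
    by_contra hno
    push Not at hno
    have hsub : (Finset.univ : Finset V) ⊆ Sᶜ.powerset.biUnion (fun A => E.image (fun u => u - shiftVec a0 A)) := by
      intro v _
      obtain ⟨A, hA, hvA⟩ := hno v
      rw [Finset.mem_biUnion]
      exact ⟨A, hA, Finset.mem_image.2 ⟨_, hvA, by simp⟩⟩
    have h1 := Finset.card_le_card hsub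
    have h2 : (Sᶜ.powerset.biUnion (fun A => E.image (fun u => u - shiftVec a0 A))).card ≤ Sᶜ.powerset.card * E.card :=
      Finset.card_biUnion_le_card_mul _ _ _ fun A _ => Finset.card_image_le
    rw [Finset.card_powerset] at h2
    have h3 : 2 ^ Sᶜ.card ≤ 2 ^ Fintype.card F := Nat.pow_le_pow_right (by norm_num) (Finset.card_le_univ _)
    rw [Finset.card_univ] at h1
    have h4 : Fintype.card V ≤ E.card * 2 ^ Fintype.card F :=
      h1.trans (h2.trans (by rw [mul_comm]; exact Nat.mul_le_mul_left _ h3))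
    have h5 : (Fintype.card V : ℝ) ≤ E.card * 2 ^ Fintype.card F := by exact_mod_cast h4
    linarith
  apply ha0
  have h1 : ∑ a, (if a = a0 then 1 else 0) * c a = c a0 := by simp
  rw [← h1]
  simp only [← alt_sum Sᶜ hSc v a0, Finset.sum_mul]
  rw [Finset.sum_comm]
  apply Finset.sum_eq_zero
  intro A hA
  simp only [mul_assoc]
  rw [← Finset.mul_sum, hzero _ (hv A hA), mul_zero]

theorem numerics (q n s t k : ℕ) (hq : 3 ≤ q) (δ : ℝ) (hδ : δ = 1 / (24 * q * Real.log q))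
    (hn1 : 1 ≤ n)
    (hn : 24 * q * Real.log q * Real.log 4 ≤ Real.log n)
    (ht : t = ⌈1 / (6 * Real.log q) * (n * Real.log n)⌉₊) (hk : (1/3 : ℝ) * n ≤ k)
    (hs : (s : ℝ) < (n : ℝ) ^ (δ * n))
    (hcore : (s : ℝ) * 4 ^ n * (1 - 1 / (2 * (q : ℝ))) ^ t < 1 → n ^ k ≤ s * q ^ t) : False := by
  have hq' : (3:ℝ) ≤ q := by exact_mod_cast hq
  have hn0 : (1:ℝ) ≤ n := by exact_mod_cast hn1
  have hnpos : (0:ℝ) < n := by linarith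
  have hlq : 1 ≤ Real.log q := by
    rw [Real.le_log_iff_exp_le (by linarith)]
    linarith [Real.exp_one_lt_d9]
  have hl4 : 1 ≤ Real.log 4 := by
    rw [Real.le_log_iff_exp_le (by linarith)]
    linarith [Real.exp_one_lt_d9]
  set lq := Real.log q
  set ln := Real.log n
  have hqlq : 3 ≤ q * lq := by nlinarith
  have hln : 0 ≤ ln := Real.log_nonneg hn0
  have hs' : (s : ℝ) < Real.exp (δ * (n * ln)) := by
    rw [Real.rpow_def_of_pos hnpos] at hs
    convert hs using 2
    ring
  have h4n : (4:ℝ) ^ n = Real.exp (n * Real.log 4) := by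
    rw [mul_comm, Real.exp_mul, Real.exp_log (by norm_num), Real.rpow_natCast]
  have htlow : 1 / (6 * lq) * (n * ln) ≤ t := by rw [ht]; exact Nat.le_ceil _
  have htup : (t:ℝ) ≤ 1 / (6 * lq) * (n * ln) + 1 := by
    rw [ht]; exact (Nat.ceil_lt_add_one (by positivity)).le
  have hr0 : 0 ≤ 1 - 1 / (2 * (q : ℝ)) := by
    rw [sub_nonneg, div_le_one (by linarith)]; linarith
  have hpow : (1 - 1 / (2 * (q : ℝ))) ^ t ≤ Real.exp (- (2 * (δ * (n * ln)))) := by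
    have : 1 - 1 / (2 * (q : ℝ)) ≤ Real.exp (-(1 / (2 * (q:ℝ)))) := by
      have := Real.add_one_le_exp (-(1 / (2 * (q:ℝ)))); linarith
    calc _ ≤ Real.exp (-(1 / (2 * (q:ℝ)))) ^ t := pow_le_pow_left₀ hr0 this t
      _ = Real.exp (-(1 / (2 * (q:ℝ)) * t)) := by rw [← Real.exp_nat_mul]; congr 1; ring
      _ ≤ _ := by
        apply Real.exp_le_exp.2
        apply neg_le_neg
        calc 2 * (δ * (n * ln)) = 1 / (2 * (q:ℝ)) * (1 / (6 * lq) * (n * ln)) := by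
              rw [hδ]; field_simp; ring
          _ ≤ _ := by gcongr
  have hδpos : 0 < δ := by rw [hδ]; positivity
  have hδln : Real.log 4 ≤ δ * ln := by
    rw [hδ, div_mul_eq_mul_div, le_div_iff₀ (by positivity)]; linarith
  have h := hcore (by
    rw [h4n]
    calc (s:ℝ) * Real.exp (n * Real.log 4) * (1 - 1 / (2 * (q : ℝ))) ^ t
        ≤ s * Real.exp (n * Real.log 4) * Real.exp (- (2 * (δ * (n * ln)))) := by gcongr
      _ < Real.exp (δ * (n * ln)) * Real.exp (n * Real.log 4) * Real.exp (- (2 * (δ * (n * ln)))) := by gcongr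
      _ = Real.exp (n * (Real.log 4 - δ * ln)) := by
        rw [← Real.exp_add, ← Real.exp_add]; congr 1; ring
      _ ≤ 1 := by
        rw [Real.exp_le_one_iff]
        nlinarith)
  have h' : (n:ℝ) ^ k ≤ s * (q:ℝ) ^ t := by exact_mod_cast h
  have e1 : (n:ℝ) ^ k = Real.exp (k * ln) := by
    rw [mul_comm, Real.exp_mul, Real.exp_log hnpos, Real.rpow_natCast]
  have e2 : (q:ℝ) ^ t = Real.exp (t * lq) := by
    rw [mul_comm, Real.exp_mul, Real.exp_log (by linarith), Real.rpow_natCast]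
  rw [e1, e2] at h'
  have h2 : Real.exp (k * ln) < Real.exp (δ * (n * ln)) * Real.exp (t * lq) :=
    h'.trans_lt (by gcongr)
  rw [← Real.exp_add, Real.exp_lt_exp] at h2
  have h3 : (t:ℝ) * lq ≤ n * ln / 6 + lq := by
    calc (t:ℝ) * lq ≤ (1 / (6 * lq) * (n * ln) + 1) * lq := by gcongr
      _ = _ := by field_simp
  have h4 : δ ≤ 1 / 72 := by
    rw [hδ]
    apply one_div_le_one_div_of_le (by norm_num); nlinarith
  have h5 : 1/3 * n * ln ≤ k * ln := by gcongr
  have h6 : δ * (n * ln) ≤ 1/72 * (n * ln) := by gcongr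
  have h7 : 72 * lq ≤ ln := by
    refine le_trans ?_ hn
    have : 72 * lq ≤ 24 * q * lq := by nlinarith
    nlinarith
  have h8 : ln ≤ n * ln := by nlinarith
  linarith

/-- Depth-3 lower bound for `NW_{n,ε}` over fixed-size finite fields: for every prime
power `q ≥ 3` there are constants `δ, ε ∈ (0,1)` (depending only on `q`) such that for
all sufficiently large prime powers `n`, any representation of `NW_{n,ε}` over `F_q` as a
sum of `s` products of affine linear forms satisfies `s ≥ n^(δ·n)`. -/
theorem depth3_lower_bound_NW :
    ∀ q : ℕ, (∃ p k : ℕ, p.Prime ∧ 0 < k ∧ q = p ^ k) → 3 ≤ q →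
    ∃ δ ε : ℝ, δ ∈ Set.Ioo (0 : ℝ) 1 ∧ ε ∈ Set.Ioo (0 : ℝ) 1 ∧
      ∃ n0 : ℕ, ∀ n : ℕ, n0 ≤ n →
        ∀ (Fq : Type) [Field Fq] [Fintype Fq], Fintype.card Fq = q →
        ∀ (Fn : Type) [Field Fn] [Fintype Fn], Fintype.card Fn = n →
        ∀ (s : ℕ) (d : ℕ → ℕ) (L : ℕ → ℕ → MvPolynomial (Fn × Fn) Fq),
          (∀ i < s, ∀ j < d i, (L i j).totalDegree ≤ 1) →
          NW Fn Fq ⌈ε * n⌉₊ = ∑ i ∈ Finset.range s, ∏ j ∈ Finset.range (d i), L i j →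
          (n : ℝ) ^ (δ * n) ≤ s := by
  intro q _ hq
  have hq' : (3:ℝ) ≤ q := by exact_mod_cast hq
  have hlq : 1 ≤ Real.log q := by
    rw [Real.le_log_iff_exp_le (by linarith)]
    linarith [Real.exp_one_lt_d9]
  refine ⟨1 / (24 * q * Real.log q), 1/3, ⟨by positivity, ?_⟩, by norm_num,
    12 + ⌈Real.exp (24 * q * Real.log q * Real.log 4)⌉₊, ?_⟩
  · rw [div_lt_one (by positivity)]; nlinarith
  intro n hn Fq _ _ hFq Fn _ _ hFn s d L hL hNW
  by_contra hcon
  push Not at hcon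
  have hn12 : (12:ℝ) ≤ n := by exact_mod_cast (show 12 ≤ n by omega)
  refine numerics q n s _ ⌈(1/3 : ℝ) * n⌉₊ hq _ rfl (by omega) ?_ rfl (Nat.le_ceil _) hcon ?_
  · rw [Real.le_log_iff_exp_le (by linarith)]
    have h0 : ⌈Real.exp (24 * q * Real.log q * Real.log 4)⌉₊ ≤ n := by omega
    exact (Nat.le_ceil _).trans (Nat.cast_le.2 h0)
  · intro h
    have hk : 2 * ⌈(1/3 : ℝ) * n⌉₊ ≤ Fintype.card Fn := by
      rw [hFn]
      have := Nat.ceil_lt_add_one (a := (1/3 : ℝ) * n) (by positivity)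
      have : (2:ℝ) * ⌈(1/3 : ℝ) * n⌉₊ ≤ n := by linarith
      exact_mod_cast this
    have := core (K := Fq) (F := Fn) ⌈(1/3 : ℝ) * n⌉₊ _ s hk d L hL hNW (by rw [hFn, hFq]; exact h)
    rw [hFn, hFq] at this
    exact this
end
end

section
/- For every prime power q ≥ 3 there exists a constant δ ∈ (0,1) depending only on q such that for all sufficiently large even integers n the following holds: whenever IMM_{n,n}, regarded as a polynomial with coefficients in F_q, is written as IMM_{n,n} = Σ_{i=1}^{s} Π_{j=1}^{d_i} L_{i,j} where each L_{i,j} is a polynomial of total degree at most 1 in the variables x^{(k)}_{ij} over F_q, then s ≥ n^{δ n}. In particular, every depth-three ΣΠΣ circuit over F_q computing IMM_{n,n} has size at least 2^{δ n log₂ n}. -/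
open MvPolynomial

noncomputable section

/-- The iterated matrix multiplication polynomial `IMM_{n,n}`: the `(1,1)` entry
(indices `0`-based) of the product of `n` generic `n × n` matrices, whose entries are the
variables `x^{(k)}_{ij}` indexed by `(k, i, j) : Fin n × Fin n × Fin n`. -/
def IMM (n : ℕ) (K : Type*) [CommSemiring K] : MvPolynomial (Fin n × Fin n × Fin n) K :=
  if h : 0 < n then
    (((List.finRange n).map fun k =>
      Matrix.of fun i j => (X (k, i, j) : MvPolynomial (Fin n × Fin n × Fin n) K)).prod)
      ⟨0, h⟩ ⟨0, h⟩
  else 0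

/-! ### Linear algebra over finite fields -/

theorem pi_surj {K V : Type*} [Field K] [AddCommGroup V] [Module K V] {κ : Type*} [Finite κ]
    (b : κ → (V →ₗ[K] K)) (h : LinearIndependent K b) :
    Function.Surjective (LinearMap.pi b) := by
  have h1 : LinearIndependent K (fun k => (b k : V → K)) :=
    h.map' (LinearMap.ltoFun K V K K) (by
      rw [LinearMap.ker_eq_bot]; intro f g hfg; exact DFunLike.coe_injective hfg)
  have h2 := (span_flip_eq_top_iff_linearIndependent).2 h1
  rw [← LinearMap.range_eq_top, eq_top_iff, ← h2, Submodule.span_le]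
  rintro _ ⟨z, rfl⟩
  exact ⟨z, rfl⟩

theorem sum_comp_surj {V W : Type*} [AddCommGroup V] [AddCommGroup W] [Fintype V] [Fintype W]
    (f : V →+ W) (hf : Function.Surjective f) (g : W → ℕ) :
    (∑ z, g (f z)) * Fintype.card W = Fintype.card V * ∑ w, g w := by
  classical
  have hc : ∀ w : W, (Finset.univ.filter fun z => f z = w).card
      = (Finset.univ.filter fun z => f z = 0).card := fun w =>
    AddMonoidHom.card_fiber_eq_of_mem_range f (hf w) (hf 0)
  have h1 : ∀ g : W → ℕ, ∑ z, g (f z)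
      = (Finset.univ.filter fun z => f z = 0).card * ∑ w, g w := by
    intro g
    rw [← Finset.sum_fiberwise (s := Finset.univ) (g := f), Finset.mul_sum]
    refine Finset.sum_congr rfl fun w _ => ?_
    rw [← hc w, ← smul_eq_mul, ← Finset.sum_const]
    refine Finset.sum_congr rfl fun z hz => ?_
    rw [(Finset.mem_filter.1 hz).2]
  have h2 := h1 (fun _ => 1)
  simp only [Finset.sum_const, Finset.card_univ, smul_eq_mul, mul_one] at h2
  rw [h1, h2]; ring

/-- Few points have at most `m` zeros among independent affine forms. -/
theorem few_zeros {K V : Type*} [Field K] [Fintype K] [AddCommGroup V] [Module K V] [Fintype V]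
    {κ : Type*} [Fintype κ] (b : κ → (V →ₗ[K] K)) (h : LinearIndependent K b) (c : κ → K)
    (m : ℕ) (E : Finset V)
    (hE : ∀ z ∈ E, ∀ S : Finset κ, (∀ k ∈ S, b k z + c k = 0) → S.card ≤ m) :
    E.card * (2 * Fintype.card K) ^ Fintype.card κ
      ≤ 2 ^ m * (2 * Fintype.card K - 1) ^ Fintype.card κ * Fintype.card V := by
  classical
  set t := Fintype.card κ
  set q := Fintype.card K
  let wt : K → ℕ := fun x => if x = 0 then 1 else 2
  have hwt : ∑ x, wt x = 2 * q - 1 := by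
    have h1 : ∑ x : K, (wt x + if x = 0 then 1 else 0) = 2 * q := by
      rw [Finset.sum_congr rfl (g := fun _ => 2)]
      · simp [q, mul_comm]
      · intro x _; simp only [wt]; split_ifs <;> rfl
    rw [Finset.sum_add_distrib] at h1
    simp at h1
    omega
  have hs := sum_comp_surj (LinearMap.pi b).toAddMonoidHom (pi_surj b h)
    (fun w => ∏ k, wt (w k + c k))
  have hW : ∑ w : κ → K, ∏ k, wt (w k + c k) = (2 * q - 1) ^ t := by
    rw [← Fintype.prod_sum (fun k x => wt (x + c k))]
    have : ∀ k, ∑ x, wt (x + c k) = 2 * q - 1 := fun k => by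
      rw [← hwt]; exact Equiv.sum_comp (Equiv.addRight (c k)) wt
    simp [this, t]
  rw [hW] at hs
  have hlow : ∀ z ∈ E, 2 ^ t ≤ 2 ^ m * ∏ k, wt (b k z + c k) := by
    intro z hz
    have h1 := hE z hz (Finset.univ.filter fun k => b k z + c k = 0) (by simp)
    have h2 : 2 ^ t = 2 ^ (Finset.univ.filter fun k => b k z + c k = 0).card
        * ∏ k, wt (b k z + c k) := by
      rw [← Finset.prod_const, Finset.prod_filter, ← Finset.prod_mul_distrib,
        Finset.prod_congr rfl (g := fun _ => 2)]
      · simp [t]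
      · intro k _; simp only [wt]; split_ifs <;> rfl
    rw [h2]
    gcongr
    norm_num
  have hsum : E.card * 2 ^ t ≤ 2 ^ m * ∑ z, ∏ k, wt (b k z + c k) := by
    rw [← smul_eq_mul, ← Finset.sum_const, Finset.mul_sum]
    exact (Finset.sum_le_sum hlow).trans
      (Finset.sum_le_sum_of_subset (Finset.subset_univ _))
  have hcard : Fintype.card (κ → K) = q ^ t := by simp [q, t]
  rw [hcard] at hs
  calc E.card * (2 * q) ^ t = E.card * 2 ^ t * q ^ t := by rw [mul_pow]; ring
    _ ≤ 2 ^ m * (∑ z, ∏ k, wt (b k z + c k)) * q ^ t := by gcongr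
    _ = 2 ^ m * ((∑ z, ∏ k, wt (b k z + c k)) * q ^ t) := by ring
    _ = _ := by
      have : (∑ z, ∏ k, wt (b k z + c k)) * q ^ t = Fintype.card V * (2 * q - 1) ^ t := hs
      rw [this]; ring

/-- A high multiplicity of vanishing factors kills low degree coefficients. -/
theorem coeff_vanish {σ K : Type*} [Field K] (J : Finset ℕ) (A : ℕ → MvPolynomial σ K)
    (hA : ∀ j, (A j).IsHomogeneous 1) (c : ℕ → K) (S : Finset ℕ) (hS : S ⊆ J)
    (hc : ∀ j ∈ S, c j = 0) (e : σ →₀ ℕ) (he : e.degree < S.card) :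
    coeff e (∏ j ∈ J, (A j + C (c j))) = 0 := by
  classical
  rw [← Finset.prod_sdiff hS, mul_comm, coeff_mul]
  have hhom : (∏ j ∈ S, (A j + C (c j))).IsHomogeneous S.card := by
    have h1 := IsHomogeneous.prod S (fun j => A j + C (c j)) (fun _ => 1) (by
      intro j hj
      simpa [hc j hj] using hA j)
    simpa using h1
  refine Finset.sum_eq_zero fun x hx => ?_
  rw [Finset.HasAntidiagonal.mem_antidiagonal] at hx
  rw [hhom.coeff_eq_zero, zero_mul]
  intro hd
  have : e.degree = x.1.degree + x.2.degree := by rw [← hx, map_add]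
  omega

/-- Monomials restricted to a dense set are independent. -/
theorem mono_dense {K : Type*} [Field K] [Fintype K] [DecidableEq K] {m n : ℕ}
    (G : Finset (Fin m × Fin n → K))
    (hG : Gᶜ.card * 2 ^ m < Fintype.card (Fin m × Fin n → K)) :
    LinearIndependent K (fun (p : Fin m → Fin n) (z : G) => ∏ t, z.1 (t, p t)) := by
  classical
  rw [Fintype.linearIndependent_iff]
  intro g hg p
  by_contra hp
  let g' : (Fin m × Fin n → K) → K := fun z => ∑ f, g f * ∏ t, z (t, f t)
  have hzero : ∀ z ∈ G, g' z = 0 := by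
    intro z hz
    have := congrFun hg ⟨z, hz⟩
    simpa [g', Finset.sum_apply] using this
  let sh : Finset (Fin m) → (Fin m × Fin n → K) := fun T x =>
    if x.1 ∈ T ∧ x.2 = p x.1 then 1 else 0
  have hex : ∀ z, ∃ T : Finset (Fin m), z + sh T ∈ Gᶜ := by
    intro z
    by_contra! hcon
    have h0 : ∀ T, g' (z + sh T) = 0 := fun T => hzero _ (by simpa using hcon T)
    have hsum : ∑ T : Finset (Fin m), (-1 : K) ^ T.card * g' (z + sh T) = 0 := by
      simp [h0]
    have key : ∀ f : Fin m → Fin n,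
        ∑ T : Finset (Fin m), (-1 : K) ^ T.card * ∏ t, (z + sh T) (t, f t)
          = if f = p then (-1) ^ m else 0 := by
      intro f
      have h1 := Finset.prod_add (fun t => -(z (t, f t) + if f t = p t then 1 else 0))
        (fun t => z (t, f t)) (Finset.univ : Finset (Fin m))
      have h2 : ∏ t : Fin m, (-(z (t, f t) + if f t = p t then 1 else 0) + z (t, f t))
          = if f = p then (-1) ^ m else 0 := by
        split_ifs with hf
        · subst hf; simp
        · obtain ⟨t, ht⟩ := Function.ne_iff.1 hf
          exact Finset.prod_eq_zero (Finset.mem_univ t) (by simp [ht])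
      rw [← h2, h1, Finset.powerset_univ]
      refine Finset.sum_congr rfl fun T _ => ?_
      rw [← Finset.prod_sdiff (Finset.subset_univ T), Finset.prod_neg, mul_assoc]
      congr 1
      rw [mul_comm]
      congr 1
      · refine Finset.prod_congr rfl fun t ht => ?_
        simp [sh, ht]
      · refine Finset.prod_congr rfl fun t ht => ?_
        simp [sh, (Finset.mem_sdiff.1 ht).2]
    have h3 : ∑ T : Finset (Fin m), (-1 : K) ^ T.card * g' (z + sh T) = g p * (-1) ^ m := by
      simp only [g', Finset.mul_sum]
      rw [Finset.sum_comm]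
      have : ∀ f, ∑ T : Finset (Fin m), (-1 : K) ^ T.card * (g f * ∏ t, (z + sh T) (t, f t))
          = g f * if f = p then (-1) ^ m else 0 := by
        intro f
        rw [← key f, Finset.mul_sum]
        exact Finset.sum_congr rfl fun T _ => by ring
      rw [Finset.sum_congr rfl fun f _ => this f]
      simp
    rw [hsum] at h3
    have : g p * (-1 : K) ^ m ≠ 0 := mul_ne_zero hp (pow_ne_zero _ (by simp))
    exact this h3.symm
  choose T hT using hex
  have hinj : Function.Injective
      (fun z => ((⟨z + sh (T z), hT z⟩ : (Gᶜ : Finset _)), T z)) := by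
    intro z z' h
    simp only [Prod.mk.injEq, Subtype.mk.injEq] at h
    rw [h.2] at h
    exact add_right_cancel h.1
  have := Fintype.card_le_of_injective _ hinj
  rw [Fintype.card_prod, Fintype.card_coe, Fintype.card_finset, Fintype.card_fin] at this
  omega

theorem low_factor {K V ι κ : Type*} [Field K] [AddCommGroup V] [Module K V]
    (B : ι → (V →ₗ[K] K)) (a : κ → ι)
    (hsp : Submodule.span K (Set.range (B ∘ a)) = Submodule.span K (Set.range B))
    (z z' : V) (h : ∀ k, B (a k) z = B (a k) z') (j : ι) : B j z = B j z' := by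
  have hj : B j ∈ Submodule.span K (Set.range (B ∘ a)) := by
    rw [hsp]; exact Submodule.subset_span ⟨j, rfl⟩
  have hle : Submodule.span K (Set.range (B ∘ a)) ≤
      LinearMap.ker (LinearMap.applyₗ (z - z') : (V →ₗ[K] K) →ₗ[K] K) := by
    rw [Submodule.span_le]
    rintro _ ⟨k, rfl⟩
    simp [h k]
  have := hle hj
  simpa [sub_eq_zero] using this

theorem coeff_prod_form {K : Type*} [Field K] {m n : ℕ} (z : Fin m × Fin n → K)
    (p : Fin m → Fin n) :
    coeff (∑ t, Finsupp.single (t, p t) 1)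
      (∏ t : Fin m, ∑ a : Fin n, C (z (t, a)) * X (t, a) : MvPolynomial (Fin m × Fin n) K)
      = ∏ t, z (t, p t) := by
  classical
  rw [Fintype.prod_sum, coeff_sum]
  have h : ∀ f : Fin m → Fin n,
      coeff (∑ t, Finsupp.single (t, p t) 1)
        (∏ t, (C (z (t, f t)) * X (t, f t)) : MvPolynomial (Fin m × Fin n) K)
      = if f = p then ∏ t, z (t, f t) else 0 := by
    intro f
    have h1 : (∏ t, (C (z (t, f t)) * X (t, f t)) : MvPolynomial (Fin m × Fin n) K)
        = monomial (∑ t, Finsupp.single (t, f t) 1) (∏ t, z (t, f t)) := by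
      rw [monomial_sum_prod]
      exact Finset.prod_congr rfl fun t _ => by rw [C_mul_X_eq_monomial]
    rw [h1, coeff_monomial]
    have h2 : ((∑ t, Finsupp.single (t, f t) 1 : Fin m × Fin n →₀ ℕ)
        = ∑ t, Finsupp.single (t, p t) 1) ↔ f = p := by
      constructor
      · intro h
        funext t
        have := DFunLike.congr_fun h (t, f t)
        simp only [Finsupp.coe_finsetSum, Finset.sum_apply, Finsupp.single_apply,
          Prod.mk.injEq] at this
        by_contra hne
        rw [Finset.sum_eq_zero (s := Finset.univ)
          (f := fun x => if x = t ∧ p x = f t then 1 else 0)] at this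
        · have h3 := Finset.single_le_sum (f := fun x => if x = t ∧ f x = f t then 1 else 0)
            (s := Finset.univ) (by intros; positivity) (Finset.mem_univ t)
          rw [this] at h3
          simp at h3
        · intro x _
          rw [if_neg]
          rintro ⟨rfl, h⟩
          exact hne h.symm
      · rintro rfl; rfl
    simp only [h2]
  simp [h]

theorem core_s1 {K : Type} [Field K] [Fintype K] (m n s : ℕ) (d : ℕ → ℕ)
    (A : ℕ → ℕ → MvPolynomial (Fin m × Fin n) K) (hA : ∀ i j, (A i j).IsHomogeneous 1)
    (B : ℕ → ℕ → ((Fin m × Fin n → K) →ₗ[K] K)) (c : ℕ → ℕ → K)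
    (H : ∀ z : Fin m × Fin n → K,
      (∏ t : Fin m, ∑ a : Fin n, C (z (t, a)) * X (t, a) : MvPolynomial (Fin m × Fin n) K)
        = ∑ i ∈ Finset.range s, ∏ j ∈ Finset.range (d i), (A i j + C (B i j z + c i j)))
    (r : ℕ) :
    n ^ m ≤ s * Fintype.card K ^ r ∨
      (2 * Fintype.card K) ^ r ≤ s * 4 ^ m * (2 * Fintype.card K - 1) ^ r := by
  classical
  by_contra! hcon
  obtain ⟨hlow, hhigh⟩ := hcon
  set q := Fintype.card K with hq
  have hq1 : 1 < q := Fintype.one_lt_card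
  have hex := fun i => exists_linearIndependent' K (fun j : Fin (d i) => B i j)
  choose κ a hinj hsp hli using hex
  have hfin : ∀ i, Finite (κ i) := fun i => Finite.of_injective _ (hinj i)
  have hft : ∀ i, Fintype (κ i) := fun i => Fintype.ofFinite _
  let e : (Fin m → Fin n) → (Fin m × Fin n →₀ ℕ) := fun p => ∑ t, Finsupp.single (t, p t) 1
  have hedeg : ∀ p, (e p).degree = m := by
    intro p; simp [e, map_sum]
  let cf : ℕ → (Fin m → Fin n) → (Fin m × Fin n → K) → K := fun i p z =>
    coeff (e p) (∏ j ∈ Finset.range (d i), (A i j + C (B i j z + c i j)))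
  have hcf : ∀ p z, ∏ t, z (t, p t) = ∑ i ∈ Finset.range s, cf i p z := by
    intro p z
    rw [← coeff_prod_form, H z, coeff_sum]
  -- the bad sets
  let E : ℕ → Finset (Fin m × Fin n → K) := fun i =>
    Finset.univ.filter fun z => ∀ S : Finset (κ i),
      (∀ k ∈ S, B i (a i k) z + c i (a i k) = 0) → S.card ≤ m
  have hE : ∀ i, (E i).card * (2 * q) ^ Fintype.card (κ i)
      ≤ 2 ^ m * (2 * q - 1) ^ Fintype.card (κ i) * Fintype.card (Fin m × Fin n → K) := by
    intro i
    exact few_zeros (fun k => B i (a i k)) (hli i) (fun k => c i (a i k)) m (E i)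
      (fun z hz => (Finset.mem_filter.1 hz).2)
  have hEv : ∀ i p z, z ∉ E i → cf i p z = 0 := by
    intro i p z hz
    simp only [E, Finset.mem_filter, Finset.mem_univ, true_and, not_forall, not_le] at hz
    obtain ⟨S, hS, hSm⟩ := hz
    have hinj' : Function.Injective (fun k => ((a i k : Fin (d i)) : ℕ)) :=
      Fin.val_injective.comp (hinj i)
    refine coeff_vanish _ (A i) (hA i) _ (S.image fun k => ((a i k : Fin (d i)) : ℕ)) ?_ ?_ _ ?_
    · intro j hj
      obtain ⟨k, _, rfl⟩ := Finset.mem_image.1 hj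
      exact Finset.mem_range.2 (a i k).2
    · intro j hj
      obtain ⟨k, hk, rfl⟩ := Finset.mem_image.1 hj
      exact hS k hk
    · rw [Finset.card_image_of_injective _ hinj', hedeg]; exact hSm
  -- high rank gates
  let hi : Finset ℕ := (Finset.range s).filter fun i => r < Fintype.card (κ i)
  have hE' : ∀ i ∈ hi, (E i).card * (2 * q) ^ r
      ≤ 2 ^ m * (2 * q - 1) ^ r * Fintype.card (Fin m × Fin n → K) := by
    intro i hi'
    have ht : r < Fintype.card (κ i) := (Finset.mem_filter.1 hi').2
    obtain ⟨u, hu⟩ := Nat.exists_eq_add_of_lt ht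
    have h1 := hE i
    rw [hu, add_assoc, pow_add _ r, pow_add _ r] at h1
    have h2 : (2 * q - 1) ^ (u + 1) ≤ (2 * q) ^ (u + 1) := by gcongr; omega
    have h3 : 0 < (2 * q) ^ (u + 1) := by positivity
    refine Nat.le_of_mul_le_mul_right ?_ h3
    calc (E i).card * (2 * q) ^ r * (2 * q) ^ (u + 1)
        = (E i).card * ((2 * q) ^ r * (2 * q) ^ (u + 1)) := by ring
      _ ≤ _ := h1
      _ ≤ 2 ^ m * ((2 * q - 1) ^ r * (2 * q) ^ (u + 1)) *
          Fintype.card (Fin m × Fin n → K) := by gcongr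
      _ = _ := by ring
  let G : Finset (Fin m × Fin n → K) := (hi.biUnion E)ᶜ
  have hG : Gᶜ.card * 2 ^ m < Fintype.card (Fin m × Fin n → K) := by
    have h0 : 0 < Fintype.card (Fin m × Fin n → K) := Fintype.card_pos
    have h1 : Gᶜ.card ≤ ∑ i ∈ hi, (E i).card := by
      simp only [G, compl_compl]; exact Finset.card_biUnion_le
    have h2 : (∑ i ∈ hi, (E i).card) * (2 * q) ^ r
        ≤ s * (2 ^ m * (2 * q - 1) ^ r * Fintype.card (Fin m × Fin n → K)) := by
      rw [Finset.sum_mul]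
      refine (Finset.sum_le_sum hE').trans ?_
      rw [Finset.sum_const, smul_eq_mul]
      gcongr
      exact (Finset.card_filter_le _ _).trans (by simp)
    have h4 : (4 : ℕ) ^ m = 2 ^ m * 2 ^ m := by rw [← mul_pow]; norm_num
    refine Nat.lt_of_mul_lt_mul_right (a := (2 * q) ^ r) ?_
    calc Gᶜ.card * 2 ^ m * (2 * q) ^ r ≤ (∑ i ∈ hi, (E i).card) * 2 ^ m * (2 * q) ^ r := by
          gcongr
      _ = 2 ^ m * ((∑ i ∈ hi, (E i).card) * (2 * q) ^ r) := by ring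
      _ ≤ 2 ^ m * (s * (2 ^ m * (2 * q - 1) ^ r * Fintype.card (Fin m × Fin n → K))) := by
          gcongr
      _ = (s * 4 ^ m * (2 * q - 1) ^ r) * Fintype.card (Fin m × Fin n → K) := by
          rw [h4]; ring
      _ < (2 * q) ^ r * Fintype.card (Fin m × Fin n → K) := by gcongr
      _ = _ := by ring
  have hind := mono_dense G hG
  -- low rank gates
  let lo : Finset ℕ := (Finset.range s).filter fun i => ¬ r < Fintype.card (κ i)
  have hsurj : ∀ i, Function.Surjective (LinearMap.pi fun k => B i (a i k)) :=
    fun i => pi_surj _ (hli i)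
  let Ω := Σ i : lo, (κ i.1 → K)
  let hp : (Fin m → Fin n) → Ω → K := fun p w => cf w.1.1 p (Function.surjInv (hsurj w.1.1) w.2)
  let Λ : (Ω → K) →ₗ[K] (G → K) :=
    LinearMap.pi fun z => ∑ i : lo, LinearMap.proj (R := K) (φ := fun _ : Ω => K)
      (⟨i, LinearMap.pi (fun k => B i.1 (a i.1 k)) z.1⟩ : Ω)
  have hΛ : ∀ p, Λ (hp p) = fun z : G => ∏ t, z.1 (t, p t) := by
    intro p
    funext z
    have hz : ∀ i ∈ hi, cf i p z.1 = 0 := by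
      intro i hi'
      apply hEv
      intro hmem
      have := z.2
      simp only [G, Finset.mem_compl, Finset.mem_biUnion, not_exists, not_and] at this
      exact this i hi' hmem
    have hsplit : ∑ i ∈ Finset.range s, cf i p z.1 = ∑ i ∈ lo, cf i p z.1 := by
      rw [← Finset.sum_filter_add_sum_filter_not (Finset.range s)
        (fun i => r < Fintype.card (κ i)), Finset.sum_eq_zero hz, zero_add]
    rw [hcf p z.1, hsplit, ← Finset.sum_coe_sort]
    simp only [Λ, LinearMap.pi_apply, LinearMap.sum_apply, LinearMap.proj_apply, hp]
    refine Finset.sum_congr rfl fun i _ => ?_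
    simp only [cf]
    congr 1
    refine Finset.prod_congr rfl fun j hj => ?_
    congr 3
    have hs := Function.surjInv_eq (hsurj i.1) (LinearMap.pi (fun k => B i.1 (a i.1 k)) z.1)
    exact low_factor (fun j : Fin (d i.1) => B i.1 j) (a i.1) (hsp i.1) _ _
      (fun k => congrFun hs k) ⟨j, Finset.mem_range.1 hj⟩
  have hind' : LinearIndependent K hp := by
    refine LinearIndependent.of_comp Λ ?_
    convert hind using 1
    funext p
    exact hΛ p
  have hcard := hind'.fintype_card_le_finrank
  rw [Module.finrank_fintype_fun_eq_card] at hcard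
  have hΩ : Fintype.card Ω ≤ s * q ^ r := by
    rw [Fintype.card_sigma]
    have h1 : ∀ i ∈ (Finset.univ : Finset lo), Fintype.card (κ i.1 → K) ≤ q ^ r := by
      intro i _
      rw [Fintype.card_fun]
      exact Nat.pow_le_pow_right (by omega) (not_lt.1 (Finset.mem_filter.1 i.2).2)
    refine (Finset.sum_le_card_nsmul _ _ _ h1).trans ?_
    rw [smul_eq_mul, Finset.card_univ, Fintype.card_coe]
    gcongr
    exact (Finset.card_filter_le _ _).trans (by simp)
  have : Fintype.card (Fin m → Fin n) = n ^ m := by simp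
  omega

theorem affine_form {σ K : Type*} [Field K] [Fintype σ] (L : MvPolynomial σ K)
    (hL : L.totalDegree ≤ 1) :
    ∃ (c : K) (w : σ → K), L = C c + ∑ v, C (w v) * X v := by
  classical
  rw [L.as_sum]
  refine Finset.sum_induction _
    (fun L : MvPolynomial σ K => ∃ (c : K) (w : σ → K), L = C c + ∑ v, C (w v) * X v) ?_ ?_ ?_
  · rintro _ _ ⟨c, w, rfl⟩ ⟨c', w', rfl⟩
    refine ⟨c + c', w + w', ?_⟩
    simp only [Pi.add_apply, C_add, add_mul, Finset.sum_add_distrib]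
    ring
  · exact ⟨0, 0, by simp⟩
  · intro e he
    have h1 : e.degree ≤ 1 := (le_totalDegree he).trans hL
    rcases Nat.le_one_iff_eq_zero_or_eq_one.1 h1 with h | h
    · rw [Finsupp.degree_eq_zero_iff] at h
      subst h
      exact ⟨coeff 0 L, 0, by simp⟩
    · obtain ⟨v, rfl⟩ := (Finsupp.sum_eq_one_iff e).1 h
      refine ⟨0, fun u => if u = v then coeff (Finsupp.single v 1) L else 0, ?_⟩
      rw [← C_mul_X_eq_monomial, Finset.sum_eq_single v]
      · simp
      · intro u _ hu; simp [hu]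
      · simp

/-- The surviving `Y`-part of the substitution. -/
def subY (K : Type) [Field K] (m : ℕ) (v : Fin (2 * m) × Fin (2 * m) × Fin (2 * m)) :
    MvPolynomial (Fin m × Fin (2 * m)) K :=
  if v.1.1 % 2 = 0 ∧ v.2.1.1 = 0 then X (⟨v.1.1 / 2, by omega⟩, v.2.2) else 0

/-- The surviving `Z`-part of the substitution. -/
def subZ (K : Type) [Field K] (m : ℕ) (v : Fin (2 * m) × Fin (2 * m) × Fin (2 * m)) :
    (Fin m × Fin (2 * m) → K) →ₗ[K] K :=
  if v.1.1 % 2 = 1 ∧ v.2.2.1 = 0 then LinearMap.proj (⟨v.1.1 / 2, by omega⟩, v.2.1) else 0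

theorem prod_single_list {R : Type*} [CommRing R] {n : ℕ} (o : Fin n) (l : List R) :
    (l.map fun x => Matrix.single o o x).prod o o = l.prod := by
  induction l with
  | nil => simp
  | cons x l ih =>
    rw [List.map_cons, List.prod_cons, List.prod_cons, Matrix.single_mul_apply_same, ih]

theorem IMM_sub {K : Type} [Field K] (m : ℕ) (hm : 0 < m) (z : Fin m × Fin (2 * m) → K) :
    aeval (fun v => subY K m v + C (subZ K m v z)) (IMM (2 * m) K)
      = (∏ t : Fin m, ∑ a : Fin (2 * m), C (z (t, a)) * X (t, a) :
          MvPolynomial (Fin m × Fin (2 * m)) K) := by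
  have h : 0 < 2 * m := by omega
  set φ : MvPolynomial (Fin (2 * m) × Fin (2 * m) × Fin (2 * m)) K →ₐ[K]
    MvPolynomial (Fin m × Fin (2 * m)) K :=
    aeval (fun v => subY K m v + C (subZ K m v z)) with hφ
  have h1 : φ (IMM (2 * m) K) = ((List.finRange (2 * m)).map fun k =>
      Matrix.of fun i j => (subY K m (k, i, j) + C (subZ K m (k, i, j) z))).prod
        ⟨0, h⟩ ⟨0, h⟩ := by
    rw [IMM, dif_pos h]
    have h2 : ∀ M : Matrix (Fin (2 * m)) (Fin (2 * m))
        (MvPolynomial (Fin (2 * m) × Fin (2 * m) × Fin (2 * m)) K),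
        φ (M ⟨0, h⟩ ⟨0, h⟩) = (φ.mapMatrix M) ⟨0, h⟩ ⟨0, h⟩ := fun M => rfl
    rw [h2, map_list_prod, List.map_map]
    have h5 : (φ.mapMatrix ∘ fun k => Matrix.of fun i j => X (k, i, j))
        = fun k => Matrix.of fun i j => (subY K m (k, i, j) + C (subZ K m (k, i, j) z)) := by
      funext k
      ext1 i j
      simp [hφ]
    rw [h5]
  rw [h1, ← List.ofFn_eq_map, List.ofFn_mul', List.prod_flatten, List.map_ofFn]
  have h3 : ∀ t : Fin m, (List.prod ∘ fun t : Fin m => List.ofFn fun j : Fin 2 =>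
      (Matrix.of fun i j' => (subY K m (⟨2 * t.1 + j.1, by omega⟩, i, j')
        + C (subZ K m (⟨2 * t.1 + j.1, by omega⟩, i, j') z)) :
        Matrix (Fin (2 * m)) (Fin (2 * m)) (MvPolynomial (Fin m × Fin (2 * m)) K))) t
      = Matrix.single ⟨0, h⟩ ⟨0, h⟩ (∑ a : Fin (2 * m), C (z (t, a)) * X (t, a)) := by
    intro t
    have e1 : (2 * t.1 + 1) % 2 = 1 := by omega
    have e2 : (2 * t.1 + 1) / 2 = t.1 := by omega
    have e3 : (2 * t.1) / 2 = t.1 := by omega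
    ext1 i j
    simp only [Function.comp, List.ofFn_succ, List.ofFn_zero, List.prod_cons, List.prod_nil,
      mul_one, Matrix.mul_apply, Matrix.of_apply, subY, subZ, Fin.val_zero, add_zero,
      Fin.val_succ, zero_add, e1, e2, e3, Nat.mul_mod_right, Matrix.single_apply]
    by_cases hi : i = ⟨0, h⟩
    · by_cases hj : j = ⟨0, h⟩
      · subst hi; subst hj
        simp [mul_comm]
      · have hj' : j.1 ≠ 0 := fun h' => hj (Fin.ext h')
        simp [hj', Ne.symm hj]
    · have hi' : i.1 ≠ 0 := fun h' => hi (Fin.ext h')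
      simp [hi', Ne.symm hi]
  rw [show (List.prod ∘ _) = _ from funext h3]
  have h4 := prod_single_list (⟨0, h⟩ : Fin (2 * m))
    (List.ofFn fun t : Fin m => (∑ a : Fin (2 * m), C (z (t, a)) * X (t, a) :
      MvPolynomial (Fin m × Fin (2 * m)) K))
  rw [List.map_ofFn, List.prod_ofFn] at h4
  exact h4

theorem IMM_core {K : Type} [Field K] [Fintype K] (m s : ℕ) (hm : 0 < m) (d : ℕ → ℕ)
    (L : ℕ → ℕ → MvPolynomial (Fin (2 * m) × Fin (2 * m) × Fin (2 * m)) K)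
    (hL : ∀ i < s, ∀ j < d i, (L i j).totalDegree ≤ 1)
    (H : IMM (2 * m) K = ∑ i ∈ Finset.range s, ∏ j ∈ Finset.range (d i), L i j) (r : ℕ) :
    (2 * m) ^ m ≤ s * Fintype.card K ^ r ∨
      (2 * Fintype.card K) ^ r ≤ s * 4 ^ m * (2 * Fintype.card K - 1) ^ r := by
  have hex : ∀ i j, ∃ (c : K) (w : Fin (2 * m) × Fin (2 * m) × Fin (2 * m) → K),
      i < s → j < d i → L i j = C c + ∑ v, C (w v) * X v := by
    intro i j
    by_cases h : i < s ∧ j < d i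
    · obtain ⟨c, w, h'⟩ := affine_form (L i j) (hL i h.1 j h.2)
      exact ⟨c, w, fun _ _ => h'⟩
    · exact ⟨0, 0, fun h1 h2 => absurd ⟨h1, h2⟩ h⟩
  choose c w hcw using hex
  refine core_s1 m (2 * m) s d (fun i j => ∑ v, C (w i j v) * subY K m v) ?_
    (fun i j => ∑ v, w i j v • subZ K m v) c ?_ r
  · intro i j
    refine IsHomogeneous.sum _ _ _ fun v _ => ?_
    have h1 : (subY K m v).IsHomogeneous 1 := by
      unfold subY
      split_ifs
      · exact isHomogeneous_X _ _
      · exact isHomogeneous_zero _ _ _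
    simpa using (isHomogeneous_C _ (w i j v)).mul h1
  · intro z
    rw [← IMM_sub m hm z, H, map_sum]
    refine Finset.sum_congr rfl fun i hi => ?_
    rw [map_prod]
    refine Finset.prod_congr rfl fun j hj => ?_
    rw [hcw i j (Finset.mem_range.1 hi) (Finset.mem_range.1 hj)]
    simp only [map_add, map_sum, map_mul, aeval_X, LinearMap.sum_apply, LinearMap.smul_apply,
      smul_eq_mul, mul_add, Finset.sum_add_distrib, algHom_C, algebraMap_eq]
    ring

/-- Depth-3 lower bound for `IMM_{n,n}` over fixed-size finite fields: for every prime
power `q ≥ 3` there is a constant `δ ∈ (0,1)` (depending only on `q`) such that for all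
sufficiently large even `n = 2m`, any representation of `IMM_{n,n}` over `F_q` as a sum
of `s` products of affine linear forms satisfies `s ≥ n^(δ·n)`. -/
theorem depth3_lower_bound_IMM :
    ∀ q : ℕ, (∃ p k : ℕ, p.Prime ∧ 0 < k ∧ q = p ^ k) → 3 ≤ q →
    ∃ δ : ℝ, δ ∈ Set.Ioo (0 : ℝ) 1 ∧
      ∃ n0 : ℕ, ∀ m : ℕ, ∀ n : ℕ, n = 2 * m → n0 ≤ n →
        ∀ (Fq : Type) [Field Fq] [Fintype Fq], Fintype.card Fq = q →
        ∀ (s : ℕ) (d : ℕ → ℕ) (L : ℕ → ℕ → MvPolynomial (Fin n × Fin n × Fin n) Fq),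
          (∀ i < s, ∀ j < d i, (L i j).totalDegree ≤ 1) →
          IMM n Fq = ∑ i ∈ Finset.range s, ∏ j ∈ Finset.range (d i), L i j →
          (n : ℝ) ^ (δ * n) ≤ s := by
  intro q _ hq3
  have hqR : (3 : ℝ) ≤ q := by exact_mod_cast hq3
  set ρ : ℝ := 2 * q / (2 * q - 1) with hρ
  have hden : (0 : ℝ) < 2 * q - 1 := by linarith
  have hρ1 : 1 < ρ := by rw [hρ, one_lt_div hden]; linarith
  have hρq : ρ ≤ q := by rw [hρ, div_le_iff₀ hden]; nlinarith
  have hlogρ : 0 < Real.log ρ := Real.log_pos hρ1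
  have hlogq : 0 < Real.log q := Real.log_pos (by linarith)
  have hll : Real.log ρ ≤ Real.log q := Real.log_le_log (by linarith) hρq
  set δ : ℝ := Real.log ρ / (8 * Real.log q) with hδ
  have hδ0 : 0 < δ := by positivity
  have hδ8 : δ ≤ 1 / 8 := by
    rw [hδ, div_le_iff₀ (by positivity)]; linarith
  have hδq : ((q : ℝ) ^ 2) ^ (4 * δ) = ρ := by
    rw [← Real.rpow_natCast, ← Real.rpow_mul (by positivity), Real.rpow_def_of_pos (by linarith)]
    have : Real.log q * ((2 : ℕ) * (4 * δ)) = Real.log ρ := by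
      rw [hδ]; push_cast; field_simp; ring
    rw [this, Real.exp_log (by linarith)]
  refine ⟨δ, ⟨hδ0, by linarith⟩, ?_⟩
  have htend : Filter.Tendsto (fun n : ℕ => (n : ℝ) ^ (2 * δ)) Filter.atTop Filter.atTop :=
    (tendsto_rpow_atTop (by positivity)).comp tendsto_natCast_atTop_atTop
  obtain ⟨n1, hn1⟩ := Filter.eventually_atTop.1 (htend.eventually_ge_atTop (4 * ρ))
  refine ⟨max n1 2, ?_⟩
  intro m n hn hn0 Fq _ _ hcard s d L hL H
  have hnn1 : 4 * ρ ≤ (n : ℝ) ^ (2 * δ) := hn1 n (le_trans (le_max_left _ _) hn0)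
  have hn2 : 2 ≤ n := le_trans (le_max_right _ _) hn0
  subst hn
  have hm : 0 < m := by omega
  have hcore := IMM_core m s hm d L hL H
  rw [hcard] at hcore
  clear hL H
  by_contra! hcon
  set n := 2 * m with hn
  have hnR : (2 : ℝ) ≤ n := by exact_mod_cast hn2
  set N : ℝ := (n : ℝ) ^ (2 * δ) with hN
  have hN0 : 0 < N := by positivity
  have hsN : (s : ℝ) < N ^ m := by
    refine hcon.trans_eq ?_
    rw [hN, ← Real.rpow_natCast, ← Real.rpow_mul (by positivity), hn]
    push_cast
    ring_nf
  set k := Nat.log (q ^ 2) n with hk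
  have hb : 1 < q ^ 2 := by nlinarith
  have hk1 : (q ^ 2) ^ k ≤ n := Nat.pow_log_le_self _ (by omega)
  have hk2 : n < (q ^ 2) ^ (k + 1) := Nat.lt_pow_succ_log_self hb _
  have hk1R : ((q : ℝ) ^ k) ^ 2 ≤ n := by
    rw [← pow_mul, mul_comm, pow_mul]; exact_mod_cast hk1
  have hk2R : (n : ℝ) ≤ ((q : ℝ) ^ 2) ^ (k + 1) := by exact_mod_cast hk2.le
  have hNN : N * N ≤ ρ ^ (k + 1) := by
    calc N * N = (n : ℝ) ^ (4 * δ) := by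
          rw [hN, ← Real.rpow_add (by positivity)]; ring_nf
      _ ≤ (((q : ℝ) ^ 2) ^ (k + 1)) ^ (4 * δ) :=
          Real.rpow_le_rpow (by positivity) hk2R (by positivity)
      _ = ρ ^ (k + 1) := by
          rw [← Real.rpow_natCast, ← Real.rpow_mul (by positivity), mul_comm,
            Real.rpow_mul (by positivity), hδq, Real.rpow_natCast]
  have h4N : N * 4 ≤ ρ ^ k := by
    have h1 : N * (4 * ρ) ≤ ρ ^ k * ρ := by
      rw [← pow_succ]; exact (mul_le_mul_of_nonneg_left hnn1 hN0.le).trans hNN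
    nlinarith
  have hNq : N * (q : ℝ) ^ k ≤ n := by
    have h1 : N ^ 2 ≤ n := by
      calc N ^ 2 = (n : ℝ) ^ (4 * δ) := by
            rw [hN, sq, ← Real.rpow_add (by positivity)]; ring_nf
        _ ≤ (n : ℝ) ^ (1 : ℝ) := Real.rpow_le_rpow_of_exponent_le (by linarith) (by linarith)
        _ = n := Real.rpow_one _
    refine (pow_le_pow_iff_left₀ (by positivity) (by positivity) two_ne_zero).1 ?_
    rw [mul_pow, sq (n : ℝ)]
    exact mul_le_mul h1 hk1R (by positivity) (by positivity)
  rcases hcore (k * m) with h | h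
  · have hR : ((n : ℝ)) ^ m ≤ s * (q : ℝ) ^ (k * m) := by exact_mod_cast h
    have : (s : ℝ) * (q : ℝ) ^ (k * m) < n ^ m := by
      calc (s : ℝ) * (q : ℝ) ^ (k * m) < N ^ m * (q : ℝ) ^ (k * m) := by gcongr
        _ = (N * (q : ℝ) ^ k) ^ m := by rw [mul_pow, pow_mul]
        _ ≤ n ^ m := by gcongr
    linarith
  · have hR : (2 * (q : ℝ)) ^ (k * m) ≤ s * 4 ^ m * (2 * q - 1) ^ (k * m) := by
      have h' : ((2 * q - 1 : ℕ) : ℝ) = 2 * q - 1 := by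
        rw [Nat.cast_sub (by omega)]; push_cast; ring
      rw [← h']; exact_mod_cast h
    have hR2 : ρ ^ (k * m) ≤ s * 4 ^ m := by
      rw [hρ, div_pow, div_le_iff₀ (by positivity)]; exact hR
    have : (s : ℝ) * 4 ^ m < ρ ^ (k * m) := by
      calc (s : ℝ) * 4 ^ m < N ^ m * 4 ^ m := by gcongr
        _ = (N * 4) ^ m := by rw [mul_pow]
        _ ≤ (ρ ^ k) ^ m := by gcongr
        _ = _ := by rw [pow_mul]
    linarith
end
end

section
/- For every prime power q ≥ 3 there exist constants δ, β, μ ∈ (0,1) depending only on q (one may take β = 1/(10 ln q), δ = 1/(20 q ln q), μ = e^{−δ/2}) such that for all sufficiently large n the following holds. Let N ≥ 1 and let f = Σ_{i=1}^{s} Π_{j=1}^{d_i} L_{i,j} ∈ F_q[x_1,…,x_N], where each L_{i,j} has total degree at most 1 and s ≤ e^{δ n ln n}. Then there exists a set E ⊆ F_q^N with |E| ≤ q^N μ^{n ln n} such that the F_q-linear span of the restrictions to F_q^N ∖ E of the evaluation functions of all partial derivatives ∂^α f with |α| ≤ n has dimension at most s · q^{⌈β n ln n⌉}. -/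
open MvPolynomial

noncomputable section

/-- Iterated partial derivative with respect to a list of variables (multi-indices `α`
with `|α| ≤ n` correspond to lists of length at most `n`). -/
def pderivList {σ : Type*} {K : Type*} [CommSemiring K] (l : List σ)
    (f : MvPolynomial σ K) : MvPolynomial σ K :=
  l.foldr (fun v g => pderiv v g) f

theorem aux_affine {K : Type*} [Field K] {N : ℕ} (p : MvPolynomial (Fin N) K)
    (hp : p.totalDegree ≤ 1) :
    ∃ (c : K) (ℓ : (Fin N → K) →ₗ[K] K), (∀ a, eval a p = ℓ a + c) ∧
      ∀ v, ∃ b, pderiv v p = C b := by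
  classical
  have key : p = C (coeff 0 p) + ∑ v, C (coeff (Finsupp.single v 1) p) * X v := by
    ext m
    simp only [coeff_add, coeff_sum, coeff_C_mul, coeff_C, coeff_X]
    by_cases h0 : m = 0
    · subst h0
      simp
    by_cases hm : ∃ v, m = Finsupp.single v 1
    · obtain ⟨v, rfl⟩ := hm
      rw [Finset.sum_eq_single v]
      · simp [h0, Ne.symm h0]
      · intro w _ hw
        rw [if_neg]
        · simp
        · intro h
          exact hw (Finsupp.single_left_injective one_ne_zero h)
      · simp
    · have : coeff m p = 0 := by
        by_contra hc
        have h1 := le_totalDegree (mem_support_iff.2 hc)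
        obtain ⟨v, hv⟩ : ∃ v, m v ≠ 0 := by
          by_contra hh
          push Not at hh
          exact h0 (Finsupp.ext hh)
        apply hm
        refine ⟨v, ?_⟩
        have hs : m.sum (fun _ e => e) = ∑ w, m w := by
          rw [Finsupp.sum_fintype]
          simp
        rw [hs, ← Finset.add_sum_erase _ _ (Finset.mem_univ v)] at h1
        have h2 : ∑ x ∈ Finset.univ.erase v, m x = 0 := by omega
        rw [Finset.sum_eq_zero_iff] at h2
        ext w
        by_cases hw : w = v
        · subst hw
          simp
          omega
        · rw [h2 w (by simp [hw]), Finsupp.single_eq_of_ne hw]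
      rw [this, if_neg (fun h => h0 h.symm), Finset.sum_eq_zero]
      · simp
      · intro v _
        rw [if_neg (fun h => hm ⟨v, h.symm⟩)]
        simp
  refine ⟨coeff 0 p, ∑ v, coeff (Finsupp.single v 1) p • LinearMap.proj v, ?_, ?_⟩
  · intro a
    conv_lhs => rw [key]
    simp [add_comm]
  · intro v
    refine ⟨coeff (Finsupp.single v 1) p, ?_⟩
    conv_lhs => rw [key]
    simp [pderiv_X, Pi.single_apply]

theorem aux_deriv_pow {K : Type*} [Field K] {N : ℕ} (I : Ideal (MvPolynomial (Fin N) K))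
    (v : Fin N) (k : ℕ) : ∀ p ∈ I ^ k, pderiv v p ∈ I ^ (k - 1) := by
  induction k with
  | zero => intro p _; simp
  | succ k ih =>
    intro p hp
    rw [pow_succ'] at hp
    simp only [Nat.add_sub_cancel]
    refine Submodule.mul_induction_on hp ?_ ?_
    · intro m hm n hn
      rw [Derivation.leibniz]
      refine add_mem ?_ ?_
      · rcases k with _ | k
        · simp
        · rw [pow_succ', smul_eq_mul]
          exact Ideal.mul_mem_mul hm (ih n hn)
      · rw [smul_eq_mul]
        exact Ideal.mul_mem_right _ _ hn
    · intro x y hx hy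
      rw [map_add]
      exact add_mem hx hy

theorem aux_list_pow {K : Type*} [Field K] {N : ℕ} (I : Ideal (MvPolynomial (Fin N) K))
    (k : ℕ) (p : MvPolynomial (Fin N) K) (hp : p ∈ I ^ k) (l : List (Fin N)) :
    pderivList l p ∈ I ^ (k - l.length) := by
  induction l with
  | nil => simpa [pderivList] using hp
  | cons v l ih =>
    have := aux_deriv_pow I v _ _ ih
    rw [Nat.sub_sub] at this
    exact this

theorem aux_vanish {K : Type*} [Field K] {N : ℕ} (d n : ℕ)
    (L : ℕ → MvPolynomial (Fin N) K) (a : Fin N → K) (J : Finset ℕ)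
    (hJ : J ⊆ Finset.range d) (hJ0 : ∀ j ∈ J, eval a (L j) = 0) (hn : n < J.card)
    (l : List (Fin N)) (hl : l.length ≤ n) :
    eval a (pderivList l (∏ j ∈ Finset.range d, L j)) = 0 := by
  have h1 : (∏ j ∈ Finset.range d, L j) ∈ (RingHom.ker (eval a)) ^ J.card := by
    rw [← Finset.prod_sdiff hJ]
    apply Ideal.mul_mem_left
    rw [← Finset.prod_const]
    exact Ideal.prod_mem_prod (fun j hj => hJ0 j hj)
  have h2 := aux_list_pow _ _ _ h1 l
  have h3 := Ideal.pow_le_self (by omega) h2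
  exact h3

theorem aux_adjoin {K : Type*} [Field K] {N : ℕ} (S : Set (MvPolynomial (Fin N) K))
    (hS : ∀ p ∈ S, ∀ v, ∃ b, pderiv v p = C b) (v : Fin N)
    (p : MvPolynomial (Fin N) K) (hp : p ∈ Algebra.adjoin K S) :
    pderiv v p ∈ Algebra.adjoin K S := by
  induction hp using Algebra.adjoin_induction with
  | mem x hx =>
    obtain ⟨b, hb⟩ := hS x hx v
    rw [hb]
    exact Subalgebra.algebraMap_mem _ b
  | algebraMap r => simp
  | add x y hx hy h1 h2 => rw [map_add]; exact add_mem h1 h2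
  | mul x y hx hy h1 h2 =>
    rw [Derivation.leibniz]
    exact add_mem (mul_mem hx h2) (mul_mem hy h1)

theorem aux_adjoin_list {K : Type*} [Field K] {N : ℕ} (S : Set (MvPolynomial (Fin N) K))
    (hS : ∀ p ∈ S, ∀ v, ∃ b, pderiv v p = C b) (l : List (Fin N))
    (p : MvPolynomial (Fin N) K) (hp : p ∈ Algebra.adjoin K S) :
    pderivList l p ∈ Algebra.adjoin K S := by
  induction l with
  | nil => exact hp
  | cons v l ih => exact aux_adjoin S hS v _ ih

theorem aux_adjoin_eval {K : Type*} [Field K] {N : ℕ} (S : Set (MvPolynomial (Fin N) K))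
    (a b : Fin N → K) (hab : ∀ p ∈ S, eval a p = eval b p)
    (p : MvPolynomial (Fin N) K) (hp : p ∈ Algebra.adjoin K S) :
    eval a p = eval b p := by
  induction hp using Algebra.adjoin_induction with
  | mem x hx => exact hab x hx
  | algebraMap r => simp
  | add x y hx hy h1 h2 => simp [h1, h2]
  | mul x y hx hy h1 h2 => simp [h1, h2]

theorem aux_surj {K V κ : Type*} [Field K] [AddCommGroup V] [Module K V] [Fintype κ]
    (ℓ : κ → V →ₗ[K] K) (h : LinearIndependent K ℓ) :
    Function.Surjective (LinearMap.pi ℓ) := by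
  classical
  rw [← LinearMap.range_eq_top]
  by_contra hne
  obtain ⟨f, hf, hle⟩ := Submodule.exists_le_ker_of_lt_top _ (lt_top_iff_ne_top.2 hne)
  apply hf
  have hsum : ∀ y : κ → K, f y = ∑ k, f (Pi.single k 1) * y k := by
    intro y
    conv_lhs => rw [← LinearMap.sum_single_apply (fun _ => K) y]
    rw [map_sum]
    refine Finset.sum_congr rfl fun k _ => ?_
    have : Pi.single k (y k) = y k • (Pi.single k (1 : K) : κ → K) := by
      rw [← Pi.single_smul]; simp
    simp [this, mul_comm]
  have h0 := Fintype.linearIndependent_iff.1 h (fun k => f (Pi.single k 1)) (by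
    ext x
    have : f (LinearMap.pi ℓ x) = 0 := hle ⟨x, rfl⟩
    rw [hsum] at this
    simpa using this)
  ext y
  simp [h0]

theorem aux_avg {G H : Type*} [AddCommGroup G] [AddCommGroup H] [Fintype G] [Fintype H]
    (φ : G →+ H) (hφ : Function.Surjective φ) (F : H → ℝ) :
    (Fintype.card H : ℝ) * ∑ a, F (φ a) = Fintype.card G * ∑ y, F y := by
  have h1 : ∀ y, ∑ a, F (φ a) = ∑ a, F (φ a + y) := by
    intro y
    obtain ⟨b, rfl⟩ := hφ y
    simp_rw [← map_add]
    exact (Equiv.sum_comp (Equiv.addRight b) (fun a => F (φ a))).symm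
  calc (Fintype.card H : ℝ) * ∑ a, F (φ a) = ∑ y : H, ∑ a, F (φ a) := by simp
    _ = ∑ y : H, ∑ a, F (φ a + y) := Finset.sum_congr rfl fun y _ => h1 y
    _ = ∑ a, ∑ y : H, F (φ a + y) := Finset.sum_comm
    _ = ∑ a : G, ∑ y : H, F y :=
      Finset.sum_congr rfl fun a _ => Equiv.sum_comp (Equiv.addLeft (φ a)) F
    _ = _ := by simp

open Classical in
theorem aux_count {K κ : Type*} [Field K] [Fintype K] [Fintype κ] {N : ℕ}
    (ℓ : κ → (Fin N → K) →ₗ[K] K) (c : κ → K) (h : LinearIndependent K ℓ) (n : ℕ) :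
    (({a : Fin N → K | (Finset.univ.filter (fun k => ℓ k a + c k = 0)).card ≤ n}.ncard : ℕ) : ℝ)
      ≤ (Fintype.card K : ℝ) ^ N *
        (2 ^ n * (1 - 1 / (2 * Fintype.card K)) ^ Fintype.card κ) := by
  set q : ℝ := (Fintype.card K : ℝ) with hq
  have hq0 : 0 < q := by
    rw [hq]; exact_mod_cast Fintype.card_pos
  let F : (κ → K) → ℝ := fun y => ∏ k, if y k + c k = 0 then (1/2 : ℝ) else 1
  have hF0 : ∀ y, 0 ≤ F y := fun y => Finset.prod_nonneg fun k _ => by split_ifs <;> norm_num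
  have hF : ∀ y, F y = (1/2) ^ (Finset.univ.filter (fun k => y k + c k = 0)).card := by
    intro y
    simp only [F]
    rw [Finset.prod_ite]
    simp
  have hFs : ∑ y, F y = (q - 1/2) ^ Fintype.card κ := by
    have : ∀ k, ∑ x : K, (if x + c k = 0 then (1/2 : ℝ) else 1) = q - 1/2 := by
      intro k
      have h2 : ∀ x : K, (if x + c k = 0 then (1/2 : ℝ) else 1)
          = 1 - if x = - c k then (1/2:ℝ) else 0 := by
        intro x
        simp only [add_eq_zero_iff_eq_neg]
        split_ifs <;> norm_num
      simp_rw [h2]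
      rw [Finset.sum_sub_distrib]
      simp [hq]
    have h3 := Finset.prod_univ_sum (fun _ : κ => (Finset.univ : Finset K))
      (fun k x => if x + c k = 0 then (1/2 : ℝ) else 1)
    simp only [this, Fintype.piFinset_univ] at h3
    rw [← h3]
    simp
  have hav := aux_avg (LinearMap.pi ℓ).toAddMonoidHom (aux_surj ℓ h) F
  rw [hFs] at hav
  simp only [Fintype.card_fun, Fintype.card_fin, Nat.cast_pow, ← hq] at hav
  have hlow : (({a : Fin N → K |
      (Finset.univ.filter (fun k => ℓ k a + c k = 0)).card ≤ n}.ncard : ℕ) : ℝ) * (1/2) ^ n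
      ≤ ∑ a, F ((LinearMap.pi ℓ).toAddMonoidHom a) := by
    rw [Set.ncard_eq_toFinset_card', Set.toFinset_ofPred, ← nsmul_eq_mul, ← Finset.sum_const]
    refine (Finset.sum_le_sum ?_).trans
      (Finset.sum_le_univ_sum_of_nonneg (fun a => hF0 _))
    intro a ha
    rw [hF]
    simp only [Finset.mem_filter, Finset.mem_univ, true_and] at ha
    exact pow_le_pow_of_le_one (by norm_num) (by norm_num) ha
  have h5 : ∑ a, F ((LinearMap.pi ℓ).toAddMonoidHom a)
      = q ^ N * (1 - 1 / (2 * q)) ^ Fintype.card κ := by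
    have : (1 - 1 / (2 * q)) = (q - 1/2) / q := by field_simp
    rw [this, div_pow]
    rw [← mul_div_assoc, ← hav, mul_div_cancel_left₀ _ (by positivity)]
  rw [h5] at hlow
  have h6 : (1/2 : ℝ) ^ n * 2 ^ n = 1 := by rw [← mul_pow]; norm_num
  have h7 := mul_le_mul_of_nonneg_right hlow (by positivity : (0:ℝ) ≤ 2 ^ n)
  rw [mul_assoc, h6, mul_one] at h7
  linarith

theorem aux_term {K : Type*} [Field K] [Fintype K] {N : ℕ} (d n r : ℕ)
    (L : ℕ → MvPolynomial (Fin N) K) (hL : ∀ j < d, (L j).totalDegree ≤ 1) :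
    ∃ E : Set (Fin N → K),
      (E.ncard : ℝ) ≤ (Fintype.card K : ℝ) ^ N *
        (2 ^ n * (1 - 1 / (2 * Fintype.card K)) ^ r) ∧
      ∃ W : Submodule K ((Fin N → K) → K), Module.finrank K W ≤ Fintype.card K ^ r ∧
        ∀ l : List (Fin N), l.length ≤ n → ∃ w ∈ W, ∀ a, a ∉ E →
          eval a (pderivList l (∏ j ∈ Finset.range d, L j)) = w a := by
  classical
  have hq1 : (1 : ℝ) ≤ Fintype.card K := by exact_mod_cast Fintype.card_pos
  have hb : (1:ℝ) / (2 * Fintype.card K) ≤ 1 := by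
    rw [div_le_one (by positivity)]; linarith
  have hb0 : (0:ℝ) ≤ 1 / (2 * Fintype.card K) := by positivity
  have haff : ∀ j : Fin d, ∃ (c : K) (ℓ : (Fin N → K) →ₗ[K] K),
      (∀ a, eval a (L j) = ℓ a + c) ∧ ∀ v, ∃ b, pderiv v (L j) = C b :=
    fun j => aux_affine _ (hL j j.2)
  choose c ℓ hev hpd using haff
  obtain ⟨κ, e, he, hspan, hli⟩ := exists_linearIndependent' K ℓ
  have : Finite κ := Finite.of_injective e he
  have := Fintype.ofFinite κ
  by_cases hκ : Fintype.card κ ≤ r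
  · refine ⟨∅, ?_, LinearMap.range (LinearMap.funLeft K K
      (fun (a : Fin N → K) (k : κ) => ℓ (e k) a)), ?_, ?_⟩
    · rw [Set.ncard_empty, Nat.cast_zero]
      have : (0:ℝ) ≤ 1 - 1 / (2 * Fintype.card K) := by linarith
      positivity
    · refine (LinearMap.finrank_range_le _).trans ?_
      rw [Module.finrank_fintype_fun_eq_card, Fintype.card_fun]
      exact Nat.pow_le_pow_right Fintype.card_pos hκ
    · intro l _
      refine ⟨_, ?_, fun a _ => rfl⟩
      set p := pderivList l (∏ j ∈ Finset.range d, L j) with hp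
      let S : Set (MvPolynomial (Fin N) K) := Set.range (fun j : Fin d => L j)
      have hpS : p ∈ Algebra.adjoin K S := by
        apply aux_adjoin_list
        · rintro _ ⟨j, rfl⟩ v
          exact hpd j v
        · refine prod_mem fun j hj => Algebra.subset_adjoin ⟨⟨j, Finset.mem_range.1 hj⟩, rfl⟩
      have hfac : ∀ a b : Fin N → K, (fun k : κ => ℓ (e k) a) = (fun k : κ => ℓ (e k) b) →
          eval a p = eval b p := by
        intro a b hab
        refine aux_adjoin_eval S a b ?_ p hpS
        rintro _ ⟨j, rfl⟩
        simp only [hev]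
        congr 1
        have hj : ℓ j ∈ Submodule.span K (Set.range (ℓ ∘ e)) := by
          rw [hspan]; exact Submodule.subset_span ⟨j, rfl⟩
        generalize ℓ j = m at hj
        induction hj using Submodule.span_induction with
        | mem x hx =>
          obtain ⟨k, rfl⟩ := hx
          exact congrFun hab k
        | zero => simp
        | add x y _ _ h1 h2 => simp [h1, h2]
        | smul t x _ h1 => simp [h1]
      obtain ⟨g, hg⟩ := (Function.factorsThrough_iff (f := fun (a : Fin N → K) (k : κ) => ℓ (e k) a)
        (fun a : Fin N → K => eval a p)).1 (fun a b hab => hfac a b hab)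
      exact ⟨g, by rw [hg]; rfl⟩
  · push Not at hκ
    refine ⟨_, (aux_count (fun k => ℓ (e k)) (fun k => c (e k)) hli n).trans ?_, ⊥, ?_, ?_⟩
    · gcongr _ * (_ * ?_)
      exact pow_le_pow_of_le_one (by linarith) (by linarith) hκ.le
    · simp
    · intro l hl
      refine ⟨0, Submodule.zero_mem _, fun a ha => ?_⟩
      simp only [Set.mem_ofPred_eq, not_le] at ha
      refine aux_vanish d n L a
        ((Finset.univ.filter (fun k => ℓ (e k) a + c (e k) = 0)).image
          (fun k => ((e k : Fin d) : ℕ))) ?_ ?_ ?_ l hl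
      · intro j hj
        obtain ⟨k, _, rfl⟩ := Finset.mem_image.1 hj
        exact Finset.mem_range.2 (e k).2
      · intro j hj
        obtain ⟨k, hk, rfl⟩ := Finset.mem_image.1 hj
        rw [hev]
        exact (Finset.mem_filter.1 hk).2
      · rw [Finset.card_image_of_injective _ (fun x y hxy => he (Fin.val_injective hxy))]
        convert ha

theorem aux_finrank_sup {K V : Type*} [Field K] [AddCommGroup V] [Module K V]
    [FiniteDimensional K V] (W : ℕ → Submodule K V) (B : ℕ) (s : ℕ)
    (h : ∀ i < s, Module.finrank K (W i) ≤ B) :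
    Module.finrank K ↥((Finset.range s).sup W) ≤ s * B := by
  induction s with
  | zero =>
    rw [Finset.range_zero, Finset.sup_empty, finrank_bot]
    exact Nat.zero_le _
  | succ s ih =>
    rw [Finset.range_add_one, Finset.sup_insert]
    have h1 := Submodule.finrank_add_le_finrank_add_finrank (W s) ((Finset.range s).sup W)
    have h2 := ih fun i hi => h i (by omega)
    have h3 := h s (by omega)
    rw [Nat.succ_mul]
    omega

theorem aux_pderivList_sum {σ K ι : Type*} [CommSemiring K] (l : List σ) (t : Finset ι)
    (f : ι → MvPolynomial σ K) :
    pderivList l (∑ i ∈ t, f i) = ∑ i ∈ t, pderivList l (f i) := by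
  induction l with
  | nil => rfl
  | cons v l ih =>
    change pderiv v (pderivList l (∑ i ∈ t, f i)) = _
    rw [ih, map_sum]
    rfl

theorem aux_real (q δ : ℝ) (hq : 1 ≤ q) (hδ : δ = 1 / (16 * q)) (n s r : ℕ)
    (hn : Real.log 2 / (2 * δ) ≤ Real.log n)
    (hs : (s : ℝ) ≤ Real.exp (δ * n * Real.log n))
    (hr : 1 / 2 * (n : ℝ) * Real.log n ≤ r) :
    s * (2 ^ n * (1 - 1 / (2 * q)) ^ r) ≤ Real.exp (-δ) ^ ((n : ℝ) * Real.log n) := by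
  have hδ0 : 0 < δ := by rw [hδ]; positivity
  have hb : 1 / (2 * q) = 8 * δ := by rw [hδ]; field_simp; norm_num
  have hb1 : 1 / (2 * q) ≤ 1 := by
    rw [div_le_one (by positivity)]; linarith
  have h1 : (1 - 1 / (2 * q)) ^ r ≤ Real.exp (-(4 * δ * (n * Real.log n))) := by
    calc (1 - 1 / (2 * q)) ^ r ≤ Real.exp (-(1 / (2 * q))) ^ r := by
          apply pow_le_pow_left₀ (by linarith)
          have := Real.add_one_le_exp (-(1 / (2 * q)))
          linarith
      _ = Real.exp (-(r * (8 * δ))) := by rw [← Real.exp_nat_mul, hb]; ring_nf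
      _ ≤ _ := by
        apply Real.exp_le_exp.2
        nlinarith
  have h2 : (2:ℝ) ^ n ≤ Real.exp (2 * δ * (n * Real.log n)) := by
    have : (2:ℝ) ^ n = Real.exp (n * Real.log 2) := by
      rw [Real.exp_nat_mul, Real.exp_log (by norm_num)]
    rw [this]
    apply Real.exp_le_exp.2
    rw [div_le_iff₀ (by positivity)] at hn
    have := mul_le_mul_of_nonneg_left hn (Nat.cast_nonneg (α := ℝ) n)
    linarith
  have h0 : 0 ≤ 1 - 1 / (2 * q) := by linarith
  calc s * (2 ^ n * (1 - 1 / (2 * q)) ^ r)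
      ≤ Real.exp (δ * n * Real.log n) * (Real.exp (2 * δ * (n * Real.log n)) *
        Real.exp (-(4 * δ * (n * Real.log n)))) := by gcongr
    _ = Real.exp (-δ) ^ ((n : ℝ) * Real.log n) := by
      rw [← Real.exp_add, ← Real.exp_add, ← Real.exp_mul]
      ring_nf

/-- Over a fixed finite field `F_q`, `q ≥ 3`, there are constants `δ, β, μ ∈ (0,1)`
(depending only on `q`) such that for all sufficiently large `n` the following holds:
if `f = Σ_{i<s} Π_{j<d i} L_{i,j} ∈ F_q[x_1,…,x_N]` with each `L_{i,j}` of total degree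
at most `1` and `s ≤ e^(δ n ln n)`, then there is a set `E ⊆ F_q^N` with
`|E| ≤ q^N μ^(n ln n)` such that the span of the restrictions to `F_q^N ∖ E` of the
evaluation functions of all partial derivatives of `f` of order at most `n` has
dimension at most `s · q^⌈β n ln n⌉`. -/
theorem depth3_derivative_space_restriction
    (Fq : Type*) [Field Fq] [Fintype Fq] (hq : 3 ≤ Fintype.card Fq) :
    ∃ δ β μ : ℝ, δ ∈ Set.Ioo (0 : ℝ) 1 ∧ β ∈ Set.Ioo (0 : ℝ) 1 ∧ μ ∈ Set.Ioo (0 : ℝ) 1 ∧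
      ∃ n0 : ℕ, ∀ n : ℕ, n0 ≤ n → ∀ N : ℕ, 1 ≤ N →
        ∀ (s : ℕ) (d : ℕ → ℕ) (L : ℕ → ℕ → MvPolynomial (Fin N) Fq),
          (∀ i < s, ∀ j < d i, (L i j).totalDegree ≤ 1) →
          (s : ℝ) ≤ Real.exp (δ * n * Real.log n) →
          ∃ E : Set (Fin N → Fq),
            (E.ncard : ℝ) ≤ (Fintype.card Fq : ℝ) ^ N * μ ^ ((n : ℝ) * Real.log n) ∧
            Module.finrank Fq ↥(Submodule.span Fq
              {g : {a : Fin N → Fq // a ∉ E} → Fq | ∃ l : List (Fin N), l.length ≤ n ∧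
                g = fun a => MvPolynomial.eval a.1
                  (pderivList l (∑ i ∈ Finset.range s, ∏ j ∈ Finset.range (d i), L i j))})
              ≤ s * Fintype.card Fq ^ ⌈β * n * Real.log n⌉₊ := by
  classical
  set q : ℝ := (Fintype.card Fq : ℝ) with hqdef
  have hq3 : (3:ℝ) ≤ q := by rw [hqdef]; exact_mod_cast hq
  have hδ0 : 0 < 1 / (16 * q) := by positivity
  have hδ1 : 1 / (16 * q) < 1 := by
    rw [div_lt_one (by positivity)]; linarith
  have hev : ∀ᶠ n : ℕ in Filter.atTop, Real.log 2 / (2 * (1 / (16 * q))) ≤ Real.log n :=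
    (Real.tendsto_log_atTop.comp tendsto_natCast_atTop_atTop).eventually_ge_atTop _
  obtain ⟨n0, hn0⟩ := Filter.eventually_atTop.1 hev
  refine ⟨1 / (16 * q), 1 / 2, Real.exp (-(1 / (16 * q))), ⟨hδ0, hδ1⟩, by norm_num,
    ⟨Real.exp_pos _, by rw [Real.exp_lt_one_iff]; linarith⟩, n0, ?_⟩
  intro n hn N _ s d L hL hs
  set r : ℕ := ⌈1 / 2 * (n : ℝ) * Real.log n⌉₊ with hr
  have hreal := aux_real q _ (by linarith) rfl n s r (hn0 n hn) hs (Nat.le_ceil _)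
  have hterm : ∀ i, ∃ E : Set (Fin N → Fq), i < s →
      (E.ncard : ℝ) ≤ q ^ N * (2 ^ n * (1 - 1 / (2 * q)) ^ r) ∧
      ∃ W : Submodule Fq ((Fin N → Fq) → Fq), Module.finrank Fq W ≤ Fintype.card Fq ^ r ∧
        ∀ l : List (Fin N), l.length ≤ n → ∃ w ∈ W, ∀ a, a ∉ E →
          eval a (pderivList l (∏ j ∈ Finset.range (d i), L i j)) = w a := by
    intro i
    by_cases hi : i < s
    · obtain ⟨E, hE⟩ := aux_term (d i) n r (L i) (hL i hi)
      exact ⟨E, fun _ => hE⟩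
    · exact ⟨∅, fun h => absurd h hi⟩
  choose E hE using hterm
  have hW : ∀ i, ∃ W : Submodule Fq ((Fin N → Fq) → Fq), i < s →
      Module.finrank Fq W ≤ Fintype.card Fq ^ r ∧
        ∀ l : List (Fin N), l.length ≤ n → ∃ w ∈ W, ∀ a, a ∉ E i →
          eval a (pderivList l (∏ j ∈ Finset.range (d i), L i j)) = w a := by
    intro i
    by_cases hi : i < s
    · obtain ⟨W, hW⟩ := (hE i hi).2
      exact ⟨W, fun _ => hW⟩
    · exact ⟨⊥, fun h => absurd h hi⟩
  choose W hW using hW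
  refine ⟨⋃ i ∈ Finset.range s, E i, ?_, ?_⟩
  · have h1 : (⋃ i ∈ Finset.range s, E i).ncard ≤ ∑ i ∈ Finset.range s, (E i).ncard :=
      Finset.set_ncard_biUnion_le _ _
    have h2 : ((∑ i ∈ Finset.range s, (E i).ncard : ℕ) : ℝ)
        ≤ s * (q ^ N * (2 ^ n * (1 - 1 / (2 * q)) ^ r)) := by
      push_cast
      refine (Finset.sum_le_card_nsmul _ _ _
        fun i hi => (hE i (Finset.mem_range.1 hi)).1).trans ?_
      simp
    have h3 := mul_le_mul_of_nonneg_left hreal (by positivity : (0:ℝ) ≤ q ^ N)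
    have h4 : ((⋃ i ∈ Finset.range s, E i).ncard : ℝ)
      ≤ ((∑ i ∈ Finset.range s, (E i).ncard : ℕ) : ℝ) := by exact_mod_cast h1
    linarith
  · set E' : Set (Fin N → Fq) := ⋃ i ∈ Finset.range s, E i with hE'
    let R : ((Fin N → Fq) → Fq) →ₗ[Fq] ({a : Fin N → Fq // a ∉ E'} → Fq) :=
      LinearMap.funLeft Fq Fq (fun a => a.1)
    refine le_trans (Submodule.finrank_mono
      (t := ((Finset.range s).sup W).map R) ?_) ((Submodule.finrank_map_le _ _).trans
      (aux_finrank_sup W _ s fun i hi => (hW i hi).1))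
    rw [Submodule.span_le]
    rintro g ⟨l, hl, rfl⟩
    have hw : ∀ i, ∃ w, i < s → w ∈ W i ∧ ∀ a, a ∉ E i →
          eval a (pderivList l (∏ j ∈ Finset.range (d i), L i j)) = w a := by
      intro i
      by_cases hi : i < s
      · obtain ⟨w, hw⟩ := (hW i hi).2 l hl
        exact ⟨w, fun _ => hw⟩
      · exact ⟨0, fun h => absurd h hi⟩
    choose w hw using hw
    refine ⟨∑ i ∈ Finset.range s, w i, ?_, ?_⟩
    · refine Submodule.sum_mem ((Finset.range s).sup W) fun i hi => ?_
      exact Finset.le_sup (f := W) hi (hw i (Finset.mem_range.1 hi)).1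
    · funext a
      change (∑ i ∈ Finset.range s, w i) a.1 = eval a.1 (pderivList l _)
      rw [aux_pderivList_sum, map_sum, Finset.sum_apply]
      refine Finset.sum_congr rfl fun i hi => ?_
      refine ((hw i (Finset.mem_range.1 hi)).2 a.1 fun h => a.2 ?_).symm
      exact Set.mem_biUnion (Finset.mem_coe.2 hi) h
end
end

section
/- Let A, S ⊆ F_q^N satisfy ⋃_{u∈S} (u + A) = F_q^N. Then ⋂_{b ∈ F_q^N} H_b = ⋂_{u∈S} T_u(⋂_{a∈A} H_a), and consequently the codimension in H of the subspace ⋂_{b ∈ F_q^N} H_b is at most |S| times the codimension in H of the subspace ⋂_{a∈A} H_a. -/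
noncomputable section

/-- `H`: the `F_q`-span, inside the space of all functions `F_q^N → F_q`, of the
monomial evaluation functions `x ↦ ∏_{i∈S} x_i` for `S` in a family `M` of subsets of
`{1,…,N}`. -/
def monomialSpan (Fq : Type*) [Field Fq] (N : ℕ) (M : Set (Finset (Fin N))) :
    Submodule Fq ((Fin N → Fq) → Fq) :=
  Submodule.span Fq ((fun S : Finset (Fin N) => fun x : Fin N → Fq => ∏ i ∈ S, x i) '' M)

/-- `H_a := {f ∈ H : f a = 0}`, as a submodule of the space of functions. -/
def monomialSpanAt (Fq : Type*) [Field Fq] (N : ℕ) (M : Set (Finset (Fin N)))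
    (a : Fin N → Fq) : Submodule Fq ((Fin N → Fq) → Fq) :=
  monomialSpan Fq N M ⊓
    LinearMap.ker (LinearMap.proj (R := Fq) (φ := fun _ : Fin N → Fq => Fq) a)

/-- The translation operator `T_u : f ↦ (x ↦ f (x − u))` as a linear map on the space of
all functions `F_q^N → F_q`. -/
def translateOp (Fq : Type*) [Field Fq] (N : ℕ) (u : Fin N → Fq) :
    ((Fin N → Fq) → Fq) →ₗ[Fq] ((Fin N → Fq) → Fq) where
  toFun f := fun x => f (x - u)
  map_add' _ _ := rfl
  map_smul' _ _ := rfl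

theorem translateOp_mem (Fq : Type*) [Field Fq] (N : ℕ) (M : Set (Finset (Fin N)))
    (hMdc : ∀ S ∈ M, ∀ S' ⊆ S, S' ∈ M) (u : Fin N → Fq) (f : (Fin N → Fq) → Fq)
    (hf : f ∈ monomialSpan Fq N M) : translateOp Fq N u f ∈ monomialSpan Fq N M := by
  have key : monomialSpan Fq N M ≤ (monomialSpan Fq N M).comap (translateOp Fq N u) := by
    conv_lhs => unfold monomialSpan
    rw [Submodule.span_le]
    rintro _ ⟨T, hT, rfl⟩
    simp only [SetLike.mem_coe, Submodule.mem_comap]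
    have h : translateOp Fq N u (fun x => ∏ i ∈ T, x i)
        = ∑ t ∈ T.powerset, (∏ i ∈ T \ t, (- u i)) • (fun x : Fin N → Fq => ∏ i ∈ t, x i) := by
      funext x
      simp only [translateOp, LinearMap.coe_mk, AddHom.coe_mk, Finset.sum_apply, Pi.smul_apply,
        smul_eq_mul, sub_eq_add_neg, Pi.add_apply, Pi.neg_apply]
      rw [Finset.prod_add]
      exact Finset.sum_congr rfl fun t _ => mul_comm _ _
    rw [h]
    refine Submodule.sum_mem _ fun t ht => Submodule.smul_mem _ _ ?_
    exact Submodule.subset_span ⟨t, hMdc T hT t (Finset.mem_powerset.mp ht), rfl⟩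
  exact key hf

theorem codim_iInf_aux {K V ι : Type*} [Field K] [AddCommGroup V] [Module K V]
    [FiniteDimensional K V] (H : Submodule K V) (W : ι → Submodule K V) (w : ℕ)
    (s : Finset ι) (hW : ∀ i ∈ s, W i ≤ H) (hw : ∀ i ∈ s, Module.finrank K (W i) = w) :
    Module.finrank K H ≤ Module.finrank K ↥(H ⊓ ⨅ i ∈ s, W i)
      + s.card * (Module.finrank K H - w) := by
  classical
  induction s using Finset.induction_on with
  | empty =>
    have e : (H ⊓ ⨅ i ∈ (∅ : Finset ι), W i) = H := by simp
    rw [e]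
    exact Nat.le_add_right _ _
  | insert i s hi ih =>
    have ih' := ih (fun j hj => hW j (Finset.mem_insert_of_mem hj))
      (fun j hj => hw j (Finset.mem_insert_of_mem hj))
    have e : (H ⊓ ⨅ j ∈ insert i s, W j) = (H ⊓ ⨅ j ∈ s, W j) ⊓ W i := by
      rw [Finset.iInf_insert, inf_comm (W i), inf_assoc]
    have h1 := Submodule.finrank_sup_add_finrank_inf_eq (H ⊓ ⨅ j ∈ s, W j) (W i)
    have h2 : Module.finrank K ↥((H ⊓ ⨅ j ∈ s, W j) ⊔ W i) ≤ Module.finrank K H :=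
      Submodule.finrank_mono (sup_le inf_le_left (hW i (Finset.mem_insert_self i s)))
    have h3 := hw i (Finset.mem_insert_self i s)
    rw [e, Finset.card_insert_of_notMem hi, add_mul, one_mul]
    omega

/-- The covering argument: let `M` be a downward-closed family of subsets of `{1,…,N}`
containing `∅`, `H` the span of the corresponding monomial functions, and
`H_a = {f ∈ H : f a = 0}`. If `A, S ⊆ F_q^N` satisfy `⋃_{u∈S} (u + A) = F_q^N`, then
`⋂_b H_b = ⋂_{u∈S} T_u (⋂_{a∈A} H_a)`, and hence the codimension in `H` of `⋂_b H_b` is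
at most `|S|` times the codimension in `H` of `⋂_{a∈A} H_a`. -/
theorem covering_argument
    (Fq : Type*) [Field Fq] [Fintype Fq] (N : ℕ) (hN : 1 ≤ N)
    (M : Set (Finset (Fin N))) (hM0 : ∅ ∈ M)
    (hMdc : ∀ S ∈ M, ∀ S' ⊆ S, S' ∈ M)
    (A S : Set (Fin N → Fq))
    (hcov : (⋃ u ∈ S, (fun a => u + a) '' A) = Set.univ) :
    (⨅ b : Fin N → Fq, monomialSpanAt Fq N M b)
      = (⨅ u ∈ S, Submodule.map (translateOp Fq N u) (⨅ a ∈ A, monomialSpanAt Fq N M a)) ∧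
    Module.finrank Fq ↥(monomialSpan Fq N M)
        - Module.finrank Fq ↥(⨅ b : Fin N → Fq, monomialSpanAt Fq N M b)
      ≤ S.ncard * (Module.finrank Fq ↥(monomialSpan Fq N M)
        - Module.finrank Fq ↥(⨅ a ∈ A, monomialSpanAt Fq N M a)) := by
  classical
  have hmem : ∀ (a : Fin N → Fq) (f), f ∈ monomialSpanAt Fq N M a ↔
      f ∈ monomialSpan Fq N M ∧ f a = 0 := by
    intro a f
    simp [monomialSpanAt]
  have hbot : (⨅ b : Fin N → Fq, monomialSpanAt Fq N M b) = ⊥ := by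
    rw [eq_bot_iff]
    intro f hf
    rw [Submodule.mem_iInf] at hf
    rw [Submodule.mem_bot]
    funext b
    exact ((hmem b f).1 (hf b)).2
  have hcov' : ∀ b : Fin N → Fq, ∃ u ∈ S, ∃ a ∈ A, u + a = b := by
    intro b
    have hb : b ∈ (⋃ u ∈ S, (fun a => u + a) '' A) := by rw [hcov]; trivial
    simpa only [Set.mem_iUnion, Set.mem_image, exists_prop] using hb
  have hfirst : (⨅ b : Fin N → Fq, monomialSpanAt Fq N M b)
      = (⨅ u ∈ S, Submodule.map (translateOp Fq N u)
          (⨅ a ∈ A, monomialSpanAt Fq N M a)) := by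
    apply le_antisymm
    · rw [hbot]; exact bot_le
    · intro f hf
      simp only [Submodule.mem_iInf] at hf
      rw [Submodule.mem_iInf]
      intro b
      obtain ⟨u, hu, a, ha, rfl⟩ := hcov' b
      obtain ⟨g, hg, rfl⟩ := hf u hu
      simp only [SetLike.mem_coe, Submodule.mem_iInf] at hg
      have hga := (hmem a g).1 (hg a ha)
      refine (hmem _ _).2 ⟨translateOp_mem Fq N M hMdc u g hga.1, ?_⟩
      simp [translateOp, hga.2]
  refine ⟨hfirst, ?_⟩
  obtain ⟨u0, hu0, a0, ha0, -⟩ := hcov' 0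
  have hinj : ∀ u, Function.Injective (translateOp Fq N u) := by
    intro u f g h
    funext x
    have := congrFun h (x + u)
    simpa [translateOp] using this
  have hfin : S.Finite := Set.toFinite S
  have hA : (⨅ a ∈ A, monomialSpanAt Fq N M a) ≤ monomialSpan Fq N M :=
    (iInf₂_le a0 ha0).trans inf_le_left
  have hmain := codim_iInf_aux (monomialSpan Fq N M)
    (fun u => Submodule.map (translateOp Fq N u) (⨅ a ∈ A, monomialSpanAt Fq N M a))
    (Module.finrank Fq ↥(⨅ a ∈ A, monomialSpanAt Fq N M a)) hfin.toFinset
    (by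
      rintro u - _ ⟨g, hg, rfl⟩
      exact translateOp_mem Fq N M hMdc u g (hA hg))
    (fun u _ => (Submodule.equivMapOfInjective _ (hinj u) _).finrank_eq.symm)
  have e : (⨅ u ∈ hfin.toFinset, Submodule.map (translateOp Fq N u)
      (⨅ a ∈ A, monomialSpanAt Fq N M a)) = (⨅ u ∈ S, Submodule.map (translateOp Fq N u)
      (⨅ a ∈ A, monomialSpanAt Fq N M a)) := by
    simp only [Set.Finite.mem_toFinset]
  rw [e, ← hfirst, hbot, inf_bot_eq, finrank_bot, zero_add,
    ← Set.ncard_eq_toFinset_card S hfin] at hmain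
  exact (Nat.sub_le _ _).trans hmain
end
end
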